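/- arXiv:1801.03112 — 7 statements merged into one kernel-verified Lean document; each statement's English description precedes it below -/
import Mathlib

section
/- Let (k,ℓ) be a pair of type (PC) and let μ > 0. Suppose s_μ and r_μ are nonnegative locally integrable functions on [0,∞) satisfying the scalar Volterra equations s_μ(t) + μ(ℓ∗s_μ)(t) = 1 and r_μ(t) + μ(ℓ∗r_μ)(t) = ℓ(t) for a.e. t > 0. Then s_μ = k∗r_μ a.e. on (0,∞), μ(1∗r_μ)(t) = 1 − s_μ(t) for a.e. t > 0, and consequently r_μ is integrable on (0,∞) with ∫_0^∞ r_μ(t) dt ≤ 1/μ. -/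
open MeasureTheory Real Set

/-- Convolution on the positive half-line: `(v ∗ w)(t) = ∫_0^t v(t-s) w(s) ds`. -/
noncomputable def hconv (f g : ℝ → ℝ) (t : ℝ) : ℝ := ∫ s in (0:ℝ)..t, f (t - s) * g s

/-- `(1 ∗ v)(t) = ∫_0^t v(s) ds`. -/
noncomputable def oneConv (f : ℝ → ℝ) (t : ℝ) : ℝ := ∫ s in (0:ℝ)..t, f s

open Filter Topology
open scoped ENNReal

section LConvolution

/-- Convolution with respect to Lebesgue measure respects almost everywhere equality. -/
theorem lconvolution_congr_ae {f f' g g' : ℝ → ℝ≥0∞} (hf : f =ᵐ[volume] f')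
    (hg : g =ᵐ[volume] g') : f ⋆ₗ g = f' ⋆ₗ g' := by
  ext x
  refine lintegral_congr_ae ?_
  have h := (quasiMeasurePreserving_sub_left_of_right_invariant (volume : Measure ℝ) x).ae hg
  filter_upwards [hf, h] with y hy hy'
  rw [hy, neg_add_eq_sub, hy']

theorem const_mul_add_lconvolution {f g h : ℝ → ℝ≥0∞} (c : ℝ≥0∞) (hf : AEMeasurable f)
    (hg : AEMeasurable g) (hh : AEMeasurable h) :
    (fun x => f x + c * g x) ⋆ₗ h = fun x => (f ⋆ₗ h) x + c * (g ⋆ₗ h) x := by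
  ext x
  have hh' : AEMeasurable (fun y => h (-y + x)) := by fun_prop
  simp only [lconvolution_def, add_mul, mul_assoc]
  rw [lintegral_add_left' (by fun_prop), lintegral_const_mul'' _ (by fun_prop)]

theorem lintegral_lconvolution {f g : ℝ → ℝ≥0∞} (hf : AEMeasurable f) (hg : AEMeasurable g) :
    ∫⁻ x, (f ⋆ₗ g) x = (∫⁻ x, f x) * ∫⁻ x, g x := by
  simp only [lconvolution_def]
  rw [lintegral_lintegral_swap (by fun_prop), ← lintegral_mul_const'' _ hf]
  refine lintegral_congr fun y => ?_
  rw [lintegral_const_mul'' _ (by fun_prop), lintegral_add_left_eq_self g (-y)]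

theorem lconvolution_ae_lt_top {f g : ℝ → ℝ≥0∞} (hf : AEMeasurable f) (hg : AEMeasurable g)
    (hf0 : ∀ x ≤ 0, f x = 0) (hg0 : ∀ x ≤ 0, g x = 0)
    (hf_fin : ∀ n : ℕ, ∫⁻ x in Iic (n : ℝ), f x ≠ ∞)
    (hg_fin : ∀ n : ℕ, ∫⁻ x in Iic (n : ℝ), g x ≠ ∞) : ∀ᵐ x, (f ⋆ₗ g) x < ∞ := by
  have key : ∀ n : ℕ, ∀ᵐ x : ℝ, x ≤ n → (f ⋆ₗ g) x < ∞ := by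
    intro n
    have hf' : AEMeasurable ((Iic (n : ℝ)).indicator f) := hf.indicator measurableSet_Iic
    have hg' : AEMeasurable ((Iic (n : ℝ)).indicator g) := hg.indicator measurableSet_Iic
    have h : ∫⁻ x, ((Iic (n : ℝ)).indicator f ⋆ₗ (Iic (n : ℝ)).indicator g) x ≠ ∞ := by
      rw [lintegral_lconvolution hf' hg', lintegral_indicator measurableSet_Iic,
        lintegral_indicator measurableSet_Iic]
      exact ENNReal.mul_ne_top (hf_fin n) (hg_fin n)
    filter_upwards [ae_lt_top' (aemeasurable_lconvolution hf' hg') h] with x hx hxn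
    refine lt_of_le_of_lt (lintegral_mono fun y => ?_) hx
    rcases le_or_gt y 0 with hy | hy
    · simp [hf0 y hy]
    rcases le_or_gt (-y + x) 0 with hy' | hy'
    · simp [hg0 _ hy']
    rw [indicator_of_mem (show y ∈ Iic (n : ℝ) by simp only [mem_Iic]; linarith),
      indicator_of_mem (show -y + x ∈ Iic (n : ℝ) by simp only [mem_Iic]; linarith)]
  filter_upwards [ae_all_iff.2 key] with x hx
  obtain ⟨n, hn⟩ := exists_nat_ge x
  exact hx n hn

end LConvolution

section HalfLine

/-- The extension of `f` from the positive half-line by zero, with values in `ℝ≥0∞`. -/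
noncomputable def halfLineExt (f : ℝ → ℝ) : ℝ → ℝ≥0∞ :=
  (Ioi 0).indicator fun t => ENNReal.ofReal (f t)

theorem halfLineExt_of_pos (f : ℝ → ℝ) {t : ℝ} (ht : 0 < t) :
    halfLineExt f t = ENNReal.ofReal (f t) := indicator_of_mem (mem_Ioi.2 ht) _

theorem halfLineExt_of_nonpos (f : ℝ → ℝ) {t : ℝ} (ht : t ≤ 0) : halfLineExt f t = 0 :=
  indicator_of_notMem (notMem_Ioi.2 ht) _

theorem aestronglyMeasurable_restrict_Ioi {f : ℝ → ℝ}
    (hf : ∀ T, 0 < T → IntegrableOn f (Ioc 0 T)) :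
    AEStronglyMeasurable f (volume.restrict (Ioi 0)) := by
  have h : Ioi (0 : ℝ) = ⋃ n : ℕ, Ioc 0 ((n : ℝ) + 1) := by
    ext x
    simp only [mem_Ioi, mem_iUnion, mem_Ioc]
    refine ⟨fun hx => ?_, fun ⟨_, hx, _⟩ => hx⟩
    obtain ⟨n, hn⟩ := exists_nat_ge x
    exact ⟨n, hx, by linarith⟩
  rw [h, aestronglyMeasurable_iUnion_iff]
  exact fun n => (hf _ (by positivity)).aestronglyMeasurable

theorem aemeasurable_halfLineExt {f : ℝ → ℝ} (hf : ∀ T, 0 < T → IntegrableOn f (Ioc 0 T)) :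
    AEMeasurable (halfLineExt f) :=
  (aemeasurable_indicator_iff measurableSet_Ioi).2
    (aestronglyMeasurable_restrict_Ioi hf).aemeasurable.ennreal_ofReal

theorem setLIntegral_Iic_halfLineExt_ne_top {f : ℝ → ℝ}
    (hf : ∀ T, 0 < T → IntegrableOn f (Ioc 0 T)) (n : ℕ) :
    ∫⁻ x in Iic (n : ℝ), halfLineExt f x ≠ ∞ := by
  rw [halfLineExt, setLIntegral_indicator measurableSet_Ioi, Ioi_inter_Iic]
  have h := (hf (n + 1) (by positivity)).mono_set (Ioc_subset_Ioc_right (by simp : (n : ℝ) ≤ n + 1))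
  exact (lt_of_le_of_lt (lintegral_ofReal_le_lintegral_enorm f) h.2).ne

theorem hconv_eq_toReal_lconvolution {f g : ℝ → ℝ} (hf0 : ∀ t, 0 < t → 0 ≤ f t)
    (hg0 : ∀ t, 0 < t → 0 ≤ g t) (hf : ∀ T, 0 < T → IntegrableOn f (Ioc 0 T))
    (hg : ∀ T, 0 < T → IntegrableOn g (Ioc 0 T)) {t : ℝ} (ht : 0 < t) :
    hconv f g t = ((halfLineExt f ⋆ₗ halfLineExt g) t).toReal := by
  have hmeas : AEStronglyMeasurable (fun s => f (t - s) * g s) (volume.restrict (Ioo 0 t)) := by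
    refine AEStronglyMeasurable.mul ?_
      ((aestronglyMeasurable_restrict_Ioi hg).mono_set Ioo_subset_Ioi_self)
    have hmp : MeasurePreserving (fun s : ℝ => t - s) (volume.restrict (Ioo 0 t))
        (volume.restrict (Ioo 0 t)) := by
      have h := (Measure.measurePreserving_sub_left (volume : Measure ℝ) t).restrict_preimage
        (measurableSet_Ioo (a := (0 : ℝ)) (b := t))
      simpa using h
    exact ((aestronglyMeasurable_restrict_Ioi hf).mono_set
      Ioo_subset_Ioi_self).comp_measurePreserving hmp
  rw [hconv, intervalIntegral.integral_of_le ht.le, integral_Ioc_eq_integral_Ioo,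
    integral_eq_lintegral_of_nonneg_ae _ hmeas]
  · rw [lconvolution_comm, lconvolution_def, ← lintegral_indicator measurableSet_Ioo]
    congr 1
    refine lintegral_congr fun s => ?_
    by_cases hs : s ∈ Ioo 0 t
    · rw [indicator_of_mem hs, halfLineExt_of_pos _ hs.1, neg_add_eq_sub,
        halfLineExt_of_pos _ (sub_pos.2 hs.2), mul_comm, ENNReal.ofReal_mul (hg0 s hs.1)]
    · rw [indicator_of_notMem hs]
      rcases le_or_gt s 0 with h | h
      · simp [halfLineExt_of_nonpos g h]
      · have : -s + t ≤ 0 := by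
          by_contra! h'
          exact hs ⟨h, by linarith⟩
        simp [halfLineExt_of_nonpos f this]
  · filter_upwards [ae_restrict_mem measurableSet_Ioo] with s hs
    exact mul_nonneg (hf0 _ (sub_pos.2 hs.2)) (hg0 _ hs.1)

theorem lconvolution_halfLineExt_of_nonpos (f g : ℝ → ℝ) {t : ℝ} (ht : t ≤ 0) :
    (halfLineExt f ⋆ₗ halfLineExt g) t = 0 := by
  rw [lconvolution_def]
  refine (lintegral_congr fun s => ?_).trans lintegral_zero
  rcases le_or_gt s 0 with h | h
  · simp [halfLineExt_of_nonpos f h]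
  · simp [halfLineExt_of_nonpos g (show -s + t ≤ 0 by linarith)]

theorem lconvolution_halfLineExt_ae_lt_top {f g : ℝ → ℝ}
    (hf : ∀ T, 0 < T → IntegrableOn f (Ioc 0 T)) (hg : ∀ T, 0 < T → IntegrableOn g (Ioc 0 T)) :
    ∀ᵐ t, (halfLineExt f ⋆ₗ halfLineExt g) t < ∞ :=
  lconvolution_ae_lt_top (aemeasurable_halfLineExt hf) (aemeasurable_halfLineExt hg)
    (fun _ => halfLineExt_of_nonpos f) (fun _ => halfLineExt_of_nonpos g)
    (setLIntegral_Iic_halfLineExt_ne_top hf) (setLIntegral_Iic_halfLineExt_ne_top hg)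

/-- A nonnegative solution of a scalar Volterra equation, written with `ℝ≥0∞`-valued
convolutions. -/
theorem halfLineExt_add_lconvolution_ae_eq {f g h : ℝ → ℝ} {μ : ℝ} (hμ : 0 < μ)
    (hf0 : ∀ t, 0 < t → 0 ≤ f t) (hg0 : ∀ t, 0 < t → 0 ≤ g t)
    (hf : ∀ T, 0 < T → IntegrableOn f (Ioc 0 T)) (hg : ∀ T, 0 < T → IntegrableOn g (Ioc 0 T))
    (heq : ∀ᵐ t ∂volume, 0 < t → g t + μ * hconv f g t = h t) :
    (fun t => halfLineExt g t + ENNReal.ofReal μ * (halfLineExt f ⋆ₗ halfLineExt g) t)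
      =ᵐ[volume] halfLineExt h := by
  filter_upwards [heq, lconvolution_halfLineExt_ae_lt_top hf hg] with t ht hfin
  rcases le_or_gt t 0 with h0 | h0
  · simp [halfLineExt_of_nonpos _ h0, lconvolution_halfLineExt_of_nonpos f g h0]
  rw [halfLineExt_of_pos _ h0, halfLineExt_of_pos _ h0, ← ht h0,
    hconv_eq_toReal_lconvolution hf0 hg0 hf hg h0,
    ENNReal.ofReal_add (hg0 t h0) (by positivity), ENNReal.ofReal_mul hμ.le,
    ENNReal.ofReal_toReal hfin.ne]

theorem hconv_one_left (f : ℝ → ℝ) : hconv (fun _ => 1) f = oneConv f := by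
  ext t
  simp [hconv, oneConv]

end HalfLine

/-- Let `(k, ℓ)` be a pair of type (PC) and `μ > 0`.  If `s_μ` and `r_μ` are nonnegative
locally integrable solutions of `s_μ + μ (ℓ ∗ s_μ) = 1` and `r_μ + μ (ℓ ∗ r_μ) = ℓ`
(a.e. on `(0,∞)`), then `s_μ = k ∗ r_μ` a.e., `μ (1 ∗ r_μ)(t) = 1 - s_μ(t)` a.e., and
`r_μ` is integrable on `(0,∞)` with `∫_0^∞ r_μ ≤ 1/μ`. -/
theorem statement0 (k ℓ sμ rμ : ℝ → ℝ) (μ : ℝ) (hμ : 0 < μ)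
    (hk_nonneg : ∀ t, 0 < t → 0 ≤ k t)
    (hk_anti : AntitoneOn k (Set.Ioi 0))
    (hk_loc : ∀ T, 0 < T → IntegrableOn k (Set.Ioc 0 T) volume)
    (hℓ_nonneg : ∀ t, 0 < t → 0 ≤ ℓ t)
    (hℓ_loc : ∀ T, 0 < T → IntegrableOn ℓ (Set.Ioc 0 T) volume)
    (hPC : ∀ t, 0 < t → hconv k ℓ t = 1)
    (hs_nonneg : ∀ t, 0 < t → 0 ≤ sμ t)
    (hs_loc : ∀ T, 0 < T → IntegrableOn sμ (Set.Ioc 0 T) volume)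
    (hr_nonneg : ∀ t, 0 < t → 0 ≤ rμ t)
    (hr_loc : ∀ T, 0 < T → IntegrableOn rμ (Set.Ioc 0 T) volume)
    (hs_eq : ∀ᵐ t ∂volume, 0 < t → sμ t + μ * hconv ℓ sμ t = 1)
    (hr_eq : ∀ᵐ t ∂volume, 0 < t → rμ t + μ * hconv ℓ rμ t = ℓ t) :
    (∀ᵐ t ∂volume, 0 < t → sμ t = hconv k rμ t) ∧
    (∀ᵐ t ∂volume, 0 < t → μ * oneConv rμ t = 1 - sμ t) ∧
    IntegrableOn rμ (Set.Ioi 0) volume ∧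
    (∫ t in Set.Ioi (0:ℝ), rμ t) ≤ 1 / μ := by
  have hone_nonneg : ∀ t : ℝ, 0 < t → (0 : ℝ) ≤ (fun _ => 1 : ℝ → ℝ) t := fun _ _ => zero_le_one
  have hone_loc : ∀ T : ℝ, 0 < T → IntegrableOn (fun _ => 1 : ℝ → ℝ) (Ioc 0 T) volume :=
    fun T _ => by simp
  have mk := aemeasurable_halfLineExt hk_loc
  have ml := aemeasurable_halfLineExt hℓ_loc
  have ms := aemeasurable_halfLineExt hs_loc
  have mr := aemeasurable_halfLineExt hr_loc
  have es := halfLineExt_add_lconvolution_ae_eq (h := fun _ => 1) hμ hℓ_nonneg hs_nonneg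
    hℓ_loc hs_loc hs_eq
  have er := halfLineExt_add_lconvolution_ae_eq hμ hℓ_nonneg hr_nonneg hℓ_loc hr_loc hr_eq
  have ekl : halfLineExt k ⋆ₗ halfLineExt ℓ = halfLineExt fun _ => 1 := by
    ext t
    rcases le_or_gt t 0 with h0 | h0
    · rw [lconvolution_halfLineExt_of_nonpos _ _ h0, halfLineExt_of_nonpos _ h0]
    · have h := hPC t h0
      rw [hconv_eq_toReal_lconvolution hk_nonneg hℓ_nonneg hk_loc hℓ_loc h0,
        ENNReal.toReal_eq_one_iff] at h
      rw [h, halfLineExt_of_pos _ h0, ENNReal.ofReal_one]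
  have els : halfLineExt ℓ ⋆ₗ halfLineExt sμ = halfLineExt (fun _ => 1) ⋆ₗ halfLineExt rμ := by
    rw [← lconvolution_congr_ae er .rfl, ← lconvolution_congr_ae es .rfl,
      const_mul_add_lconvolution _ mr (aemeasurable_lconvolution ml mr) ms,
      const_mul_add_lconvolution _ ms (aemeasurable_lconvolution ml ms) mr,
      ← lconvolution_assoc₀ ml mr ms, ← lconvolution_assoc₀ ml ms mr,
      lconvolution_comm (f := halfLineExt sμ)]
  have ekr : (fun t => (halfLineExt k ⋆ₗ halfLineExt rμ) t +
      ENNReal.ofReal μ * (halfLineExt (fun _ => 1) ⋆ₗ halfLineExt rμ) t) =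
      halfLineExt fun _ => 1 := by
    rw [← ekl, ← lconvolution_assoc₀ mk ml mr, ← lconvolution_congr_ae .rfl er,
      lconvolution_comm (f := halfLineExt k) (g := fun t => _ + _),
      const_mul_add_lconvolution _ mr (aemeasurable_lconvolution ml mr) mk,
      lconvolution_comm (f := halfLineExt k), lconvolution_comm (f := halfLineExt k)]
  have hkr : ∀ t, 0 < t → hconv k rμ t + μ * oneConv rμ t = 1 := by
    intro t ht
    have h := congrFun ekr t
    rw [halfLineExt_of_pos _ ht, ENNReal.ofReal_one] at h
    have hfin : (halfLineExt k ⋆ₗ halfLineExt rμ) t +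
      ENNReal.ofReal μ * (halfLineExt (fun _ => 1) ⋆ₗ halfLineExt rμ) t ≠ ∞ := by simp [h]
    have h' := congrArg ENNReal.toReal h
    rw [ENNReal.add_ne_top] at hfin
    rwa [ENNReal.toReal_add hfin.1 hfin.2, ENNReal.toReal_mul, ENNReal.toReal_ofReal hμ.le,
      ← hconv_eq_toReal_lconvolution hk_nonneg hr_nonneg hk_loc hr_loc ht,
      ← hconv_eq_toReal_lconvolution hone_nonneg hr_nonneg hone_loc hr_loc ht,
      hconv_one_left, ENNReal.toReal_one] at h'
  have hs : ∀ᵐ t ∂volume, 0 < t → sμ t + μ * oneConv rμ t = 1 := by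
    filter_upwards [hs_eq] with t ht h0
    rw [← ht h0, hconv_eq_toReal_lconvolution hℓ_nonneg hs_nonneg hℓ_loc hs_loc h0, els,
      ← hconv_eq_toReal_lconvolution hone_nonneg hr_nonneg hone_loc hr_loc h0, hconv_one_left]
  have hbound : ∀ t, 0 < t → ∫ x in (0 : ℝ)..t, rμ x ≤ 1 / μ := by
    intro t ht
    have hnn : 0 ≤ hconv k rμ t := by
      rw [hconv_eq_toReal_lconvolution hk_nonneg hr_nonneg hk_loc hr_loc ht]
      exact ENNReal.toReal_nonneg
    have h := hkr t ht
    rw [le_div_iff₀ hμ, mul_comm]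
    rw [oneConv] at h
    linarith
  have hint : IntegrableOn rμ (Ioi 0) volume := by
    refine integrableOn_Ioi_of_intervalIntegral_norm_bounded (b := id) (l := atTop) (1 / μ) 0
      (fun T => ?_) tendsto_id ?_
    · rcases le_or_gt T 0 with h | h
      · simp [Ioc_eq_empty_of_le h]
      · exact hr_loc T h
    · filter_upwards [eventually_gt_atTop 0] with T hT
      refine le_of_eq_of_le ?_ (hbound T hT)
      refine intervalIntegral.integral_congr_ae (Eventually.of_forall fun x hx => ?_)
      rw [id, uIoc_of_le hT.le] at hx
      exact Real.norm_of_nonneg (hr_nonneg x hx.1)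
  refine ⟨?_, ?_, hint, ?_⟩
  · filter_upwards [hs] with t ht h0
    linarith [ht h0, hkr t h0]
  · filter_upwards [hs] with t ht h0
    linarith [ht h0]
  · refine le_of_tendsto (intervalIntegral_tendsto_integral_Ioi 0 hint tendsto_id) ?_
    filter_upwards [eventually_gt_atTop 0] with T hT using hbound T hT
end

section
/- Let ℓ be a nonnegative locally integrable function on [0,∞). Suppose that for each parameter μ ∈ ℝ, r(·,μ) is a locally integrable function on [0,∞) satisfying r(t,μ) + μ(ℓ∗r(·,μ))(t) = ℓ(t) for a.e. t > 0, and that for every integer n ≥ 1 the partial derivative ∂_μ^n r(t,μ) exists for a.e. t > 0, is locally integrable in t, and satisfies the differentiated equation ∂_μ^n r(·,μ) + μ(ℓ∗∂_μ^n r(·,μ)) = −n (ℓ∗∂_μ^{n−1} r(·,μ)) a.e. on (0,∞). Then for every integer n ≥ 0 and every μ ∈ ℝ, ∂_μ^n r(t,μ) = (−1)^n · n! · r(·,μ)^{∗(n+1)}(t) for a.e. t > 0, where r(·,μ)^{∗(n+1)} denotes the (n+1)-fold convolution power of r(·,μ) on the half-line (r^{∗1} := r, r^{∗(m+1)} :=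 r ∗ r^{∗m}). -/
open MeasureTheory Real Set

/-- Convolution powers on the half-line: `convPow f n = f^{∗(n+1)}`, i.e.
`f^{∗1} := f` and `f^{∗(m+1)} := f ∗ f^{∗m}`. -/
noncomputable def convPow (f : ℝ → ℝ) : ℕ → ℝ → ℝ
  | 0 => f
  | n + 1 => hconv f (convPow f n)

section HalfLine

open Filter Convolution ContinuousLinearMap

/-- Local integrability on the closed half-line `[0,∞)`. -/
def LocIntegrableHalfLine (f : ℝ → ℝ) : Prop :=
  ∀ T, 0 < T → IntegrableOn f (Set.Ioc 0 T) volume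

/-- The measure on the positive half-line. -/
noncomputable abbrev halfLineMeasure : Measure ℝ := volume.restrict (Set.Ioi 0)

lemma ae_halfLine_iff {p : ℝ → Prop} :
    (∀ᵐ t ∂halfLineMeasure, p t) ↔ ∀ᵐ t ∂volume, 0 < t → p t :=
  ae_restrict_iff' measurableSet_Ioi

lemma ae_halfLine_of_forall_le {p : ℝ → Prop}
    (h : ∀ T : ℝ, 0 < T → ∀ᵐ t ∂volume, 0 < t → t ≤ T → p t) :
    ∀ᵐ t ∂halfLineMeasure, p t := by
  rw [ae_halfLine_iff]
  have h' : ∀ n : ℕ, ∀ᵐ t ∂volume, 0 < t → t ≤ (n : ℝ) + 1 → p t :=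
    fun n => h _ (by positivity)
  filter_upwards [ae_all_iff.2 h'] with t ht h0
  obtain ⟨n, hn⟩ := exists_nat_ge t
  exact ht n h0 (by linarith)

lemma LocIntegrableHalfLine.add {f g : ℝ → ℝ} (hf : LocIntegrableHalfLine f)
    (hg : LocIntegrableHalfLine g) : LocIntegrableHalfLine (f + g) :=
  fun T hT => (hf T hT).add (hg T hT)

lemma LocIntegrableHalfLine.smul {f : ℝ → ℝ} (c : ℝ) (hf : LocIntegrableHalfLine f) :
    LocIntegrableHalfLine (c • f) :=
  fun T hT => (hf T hT).smul c

lemma hconv_congr_Ioo {f f' g g' : ℝ → ℝ} {t : ℝ} (ht : 0 < t)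
    (hf : ∀ s ∈ Set.Ioo 0 t, f s = f' s) (hg : ∀ s ∈ Set.Ioo 0 t, g s = g' s) :
    hconv f g t = hconv f' g' t := by
  unfold hconv
  rw [intervalIntegral.integral_of_le ht.le, intervalIntegral.integral_of_le ht.le,
    integral_Ioc_eq_integral_Ioo, integral_Ioc_eq_integral_Ioo]
  refine setIntegral_congr_fun measurableSet_Ioo fun s hs => ?_
  rw [hf (t - s) ⟨by linarith [hs.2], by linarith [hs.1]⟩, hg s hs]

lemma hconv_congr {f f' g g' : ℝ → ℝ} (hf : f =ᵐ[halfLineMeasure] f')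
    (hg : g =ᵐ[halfLineMeasure] g') {t : ℝ} (ht : 0 < t) :
    hconv f g t = hconv f' g' t := by
  have hf₁ : ∀ᵐ s ∂volume, 0 < t - s → f (t - s) = f' (t - s) :=
    (Measure.measurePreserving_sub_left volume t).quasiMeasurePreserving.ae (ae_halfLine_iff.1 hf)
  unfold hconv
  rw [intervalIntegral.integral_of_le ht.le, intervalIntegral.integral_of_le ht.le,
    integral_Ioc_eq_integral_Ioo, integral_Ioc_eq_integral_Ioo]
  refine setIntegral_congr_ae measurableSet_Ioo ?_
  filter_upwards [hf₁, ae_halfLine_iff.1 hg] with s h₁ h₂ hs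
  rw [h₁ (by linarith [hs.2]), h₂ hs.1]

lemma hconv_ae_congr {f f' g g' : ℝ → ℝ} (hf : f =ᵐ[halfLineMeasure] f')
    (hg : g =ᵐ[halfLineMeasure] g') : hconv f g =ᵐ[halfLineMeasure] hconv f' g' :=
  ae_halfLine_iff.2 (Eventually.of_forall fun _ ht => hconv_congr hf hg ht)

lemma hconv_comm (f g : ℝ → ℝ) : hconv f g = hconv g f := by
  ext t
  unfold hconv
  have h := intervalIntegral.integral_comp_sub_left (a := 0) (b := t)
    (fun s => f (t - s) * g s) t
  simp only [sub_self, sub_zero] at h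
  rw [← h]
  refine intervalIntegral.integral_congr fun s _ => ?_
  simp only [sub_sub_cancel]
  ring

lemma hconv_smul_right (c : ℝ) (f g : ℝ → ℝ) : hconv f (c • g) = c • hconv f g := by
  ext t
  simp only [hconv, Pi.smul_apply, smul_eq_mul]
  rw [← intervalIntegral.integral_const_mul]
  refine intervalIntegral.integral_congr fun s _ => ?_
  ring

lemma hconv_smul_left (c : ℝ) (f g : ℝ → ℝ) : hconv (c • f) g = c • hconv f g := by
  rw [hconv_comm, hconv_smul_right, hconv_comm]

/-- Restriction of a function to `(0,T]`, extended by zero. -/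
noncomputable def truncIoc (T : ℝ) (f : ℝ → ℝ) : ℝ → ℝ := (Set.Ioc 0 T).indicator f

lemma truncIoc_of_nonpos {T : ℝ} (f : ℝ → ℝ) {t : ℝ} (ht : t ≤ 0) : truncIoc T f t = 0 :=
  Set.indicator_of_notMem (fun h => absurd h.1 ht.not_gt) f

lemma truncIoc_of_mem {T : ℝ} (f : ℝ → ℝ) {t : ℝ} (ht : t ∈ Set.Ioc 0 T) :
    truncIoc T f t = f t :=
  Set.indicator_of_mem ht f

lemma LocIntegrableHalfLine.integrable_truncIoc {f : ℝ → ℝ} (hf : LocIntegrableHalfLine f)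
    {T : ℝ} (hT : 0 < T) : Integrable (truncIoc T f) volume :=
  (integrable_indicator_iff measurableSet_Ioc).2 (hf T hT)

lemma hconv_truncIoc {T t : ℝ} (ht : 0 < t) (htT : t ≤ T) (f g : ℝ → ℝ) :
    hconv (truncIoc T f) (truncIoc T g) t = hconv f g t :=
  hconv_congr_Ioo ht (fun _ hs => truncIoc_of_mem f ⟨hs.1, hs.2.le.trans htT⟩)
    (fun _ hs => truncIoc_of_mem g ⟨hs.1, hs.2.le.trans htT⟩)

lemma convolution_eq_zero_of_nonpos {f g : ℝ → ℝ} (hf : ∀ s ≤ 0, f s = 0)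
    (hg : ∀ s ≤ 0, g s = 0) {t : ℝ} (ht : t ≤ 0) : (f ⋆[mul ℝ ℝ, volume] g) t = 0 := by
  rw [convolution_mul]
  refine integral_eq_zero_of_ae (Eventually.of_forall fun s => ?_)
  rcases le_or_gt s 0 with hs | hs
  · simp [hf s hs]
  · simp [hg (t - s) (by linarith)]

lemma convolution_eq_hconv {f g : ℝ → ℝ} (hf : ∀ s ≤ 0, f s = 0) (hg : ∀ s ≤ 0, g s = 0)
    {t : ℝ} (ht : 0 < t) : (f ⋆[mul ℝ ℝ, volume] g) t = hconv g f t := by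
  rw [convolution_mul, hconv, intervalIntegral.integral_of_le ht.le,
    integral_Ioc_eq_integral_Ioo, ← integral_indicator measurableSet_Ioo]
  refine integral_congr_ae (Eventually.of_forall fun s => ?_)
  simp only
  by_cases hs : s ∈ Set.Ioo 0 t
  · rw [Set.indicator_of_mem hs, mul_comm]
  · rw [Set.indicator_of_notMem hs]
    rcases le_or_gt s 0 with h0 | h0
    · simp [hf s h0]
    · have : t ≤ s := not_lt.1 fun h => hs ⟨h0, h⟩
      simp [hg (t - s) (by linarith)]

lemma truncIoc_convolution_eq_hconv {T t : ℝ} (ht : 0 < t) (htT : t ≤ T) (f g : ℝ → ℝ) :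
    (truncIoc T f ⋆[mul ℝ ℝ, volume] truncIoc T g) t = hconv g f t := by
  rw [convolution_eq_hconv (fun _ => truncIoc_of_nonpos f) (fun _ => truncIoc_of_nonpos g) ht,
    hconv_truncIoc ht htT]

lemma LocIntegrableHalfLine.hconv {f g : ℝ → ℝ} (hf : LocIntegrableHalfLine f)
    (hg : LocIntegrableHalfLine g) : LocIntegrableHalfLine (hconv f g) := by
  intro T hT
  have h := (hg.integrable_truncIoc hT).integrable_convolution (mul ℝ ℝ)
    (hf.integrable_truncIoc hT)
  exact h.integrableOn.congr_fun
    (fun t ht => truncIoc_convolution_eq_hconv ht.1 ht.2 g f) measurableSet_Ioc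

lemma LocIntegrableHalfLine.convPow {f : ℝ → ℝ} (hf : LocIntegrableHalfLine f) (n : ℕ) :
    LocIntegrableHalfLine (convPow f n) := by
  induction n with
  | zero => exact hf
  | succ n ih => exact hf.hconv ih

lemma ae_intervalIntegrable_hconv {f g : ℝ → ℝ} (hf : LocIntegrableHalfLine f)
    (hg : LocIntegrableHalfLine g) :
    ∀ᵐ t ∂halfLineMeasure, IntervalIntegrable (fun s => f (t - s) * g s) volume 0 t := by
  refine ae_halfLine_of_forall_le fun T hT => ?_
  filter_upwards [(hg.integrable_truncIoc hT).ae_convolution_exists (mul ℝ ℝ)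
    (hf.integrable_truncIoc hT)] with t h ht htT
  rw [intervalIntegrable_iff_integrableOn_Ioo_of_le ht.le]
  refine h.integrable.integrableOn.congr_fun (fun s hs => ?_) measurableSet_Ioo
  simp only [mul_apply']
  rw [truncIoc_of_mem g ⟨hs.1, hs.2.le.trans htT⟩,
    truncIoc_of_mem f ⟨by linarith [hs.2], by linarith [hs.1]⟩, mul_comm]

lemma hconv_add_right {f g h : ℝ → ℝ} (hf : LocIntegrableHalfLine f)
    (hg : LocIntegrableHalfLine g) (hh : LocIntegrableHalfLine h) :
    hconv f (g + h) =ᵐ[halfLineMeasure] hconv f g + hconv f h := by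
  filter_upwards [ae_intervalIntegrable_hconv hf hg, ae_intervalIntegrable_hconv hf hh]
    with t h₁ h₂
  simp only [hconv, Pi.add_apply, mul_add]
  exact intervalIntegral.integral_add h₁ h₂

lemma hconv_add_left {f g h : ℝ → ℝ} (hf : LocIntegrableHalfLine f)
    (hg : LocIntegrableHalfLine g) (hh : LocIntegrableHalfLine h) :
    hconv (f + g) h =ᵐ[halfLineMeasure] hconv f h + hconv g h := by
  rw [hconv_comm (f + g), hconv_comm f, hconv_comm g]
  exact hconv_add_right hh hf hg

lemma hconv_assoc {f g h : ℝ → ℝ} (hf : LocIntegrableHalfLine f)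
    (hg : LocIntegrableHalfLine g) (hh : LocIntegrableHalfLine h) :
    hconv (hconv f g) h =ᵐ[halfLineMeasure] hconv f (hconv g h) := by
  refine ae_halfLine_of_forall_le fun T hT => ?_
  have hF := hf.integrable_truncIoc hT
  have hG := hg.integrable_truncIoc hT
  have hH := hh.integrable_truncIoc hT
  filter_upwards [hH.norm.ae_convolution_exists (mul ℝ ℝ)
    (hG.norm.integrable_convolution (mul ℝ ℝ) hF.norm)] with t hex ht htT
  have hassoc := convolution_assoc (mul ℝ ℝ) (mul ℝ ℝ) (mul ℝ ℝ) (mul ℝ ℝ)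
    (fun x y z => mul_assoc x y z) (x₀ := t) hH.aestronglyMeasurable hG.aestronglyMeasurable
    hF.aestronglyMeasurable (hH.ae_convolution_exists (mul ℝ ℝ) hG)
    (hG.norm.ae_convolution_exists (mul ℝ ℝ) hF.norm) hex
  have hf0 : ∀ s ≤ 0, truncIoc T f s = 0 := fun _ => truncIoc_of_nonpos f
  have hg0 : ∀ s ≤ 0, truncIoc T g s = 0 := fun _ => truncIoc_of_nonpos g
  have hh0 : ∀ s ≤ 0, truncIoc T h s = 0 := fun _ => truncIoc_of_nonpos h
  rw [convolution_eq_hconv (fun _ => convolution_eq_zero_of_nonpos hh0 hg0) hf0 ht,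
    convolution_eq_hconv hh0 (fun _ => convolution_eq_zero_of_nonpos hg0 hf0) ht] at hassoc
  have hconv_eq : ∀ u v : ℝ → ℝ, ∀ s ∈ Set.Ioo 0 t,
      (truncIoc T u ⋆[mul ℝ ℝ, volume] truncIoc T v) s = hconv v u s :=
    fun u v s hs => truncIoc_convolution_eq_hconv hs.1 (hs.2.le.trans htT) u v
  have htrunc : ∀ u : ℝ → ℝ, ∀ s ∈ Set.Ioo 0 t, truncIoc T u s = u s :=
    fun u s hs => truncIoc_of_mem u ⟨hs.1, hs.2.le.trans htT⟩
  rw [hconv_congr_Ioo ht (htrunc f) (hconv_eq h g),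
    hconv_congr_Ioo ht (hconv_eq g f) (htrunc h)] at hassoc
  exact hassoc.symm

/-- Convolving the resolvent equation `r + μ (ℓ ∗ r) = ℓ` with `c`. -/
lemma resolvent_hconv {ℓ r c : ℝ → ℝ} {μ : ℝ} (hℓ : LocIntegrableHalfLine ℓ)
    (hr : LocIntegrableHalfLine r) (hc : LocIntegrableHalfLine c)
    (heq : r + μ • hconv ℓ r =ᵐ[halfLineMeasure] ℓ) :
    hconv r c + μ • hconv ℓ (hconv r c) =ᵐ[halfLineMeasure] hconv ℓ c := by
  have h₁ := hconv_ae_congr heq (EventuallyEq.refl (ae halfLineMeasure) c)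
  have h₂ := hconv_add_left hr ((hℓ.hconv hr).smul μ) hc
  rw [hconv_smul_left] at h₂
  filter_upwards [h₁, h₂, hconv_assoc hℓ hr hc] with t h₁ h₂ h₃
  simp only [Pi.add_apply, Pi.smul_apply] at h₂ ⊢
  rw [← h₁, h₂, h₃]

/-- Uniqueness for the Volterra equation whose kernel admits a resolvent. -/
lemma volterra_ae_eq_zero {ℓ r w : ℝ → ℝ} {μ : ℝ} (hℓ : LocIntegrableHalfLine ℓ)
    (hr : LocIntegrableHalfLine r) (hw : LocIntegrableHalfLine w)
    (heq : r + μ • hconv ℓ r =ᵐ[halfLineMeasure] ℓ)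
    (hw_eq : w + μ • hconv ℓ w =ᵐ[halfLineMeasure] 0) :
    w =ᵐ[halfLineMeasure] 0 := by
  have h₁ := resolvent_hconv hℓ hr hw heq
  have h₂ := hconv_add_right hr hw ((hℓ.hconv hw).smul μ)
  rw [hconv_smul_right] at h₂
  have h₃ := hconv_ae_congr (EventuallyEq.refl (ae halfLineMeasure) r) hw_eq
  have h₄ := hconv_assoc hℓ hr hw
  rw [hconv_comm ℓ r] at h₄
  have h₅ := hconv_assoc hr hℓ hw
  filter_upwards [h₁, h₂, h₃, h₄, h₅, hw_eq] with t h₁ h₂ h₃ h₄ h₅ h₆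
  have h₀ : hconv r 0 t = 0 := by simp [hconv]
  simp only [Pi.add_apply, Pi.smul_apply, Pi.zero_apply, smul_eq_mul] at h₁ h₂ h₆ ⊢
  rw [← h₄, h₅, ← h₂, h₃, h₀] at h₁
  rw [← h₁] at h₆
  simpa using h₆

end HalfLine

/-- Let `ℓ` be nonnegative and locally integrable on `[0,∞)`.  Suppose for each `μ ∈ ℝ` the
kernel `r(·,μ)` is locally integrable and solves `r(·,μ) + μ (ℓ ∗ r(·,μ)) = ℓ` a.e.; suppose
moreover that all the parameter derivatives `D n t μ = ∂_μ^n r(t,μ)` exist for a.e. `t`, are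
locally integrable in `t`, and satisfy
`∂_μ^n r + μ (ℓ ∗ ∂_μ^n r) = -n (ℓ ∗ ∂_μ^{n-1} r)` a.e. for every `n ≥ 1`.
Then `∂_μ^n r(t,μ) = (-1)^n n! r(·,μ)^{∗(n+1)}(t)` for a.e. `t > 0`. -/
theorem statement1 (ℓ : ℝ → ℝ)
    (hℓ_nonneg : ∀ t, 0 < t → 0 ≤ ℓ t)
    (hℓ_loc : ∀ T, 0 < T → IntegrableOn ℓ (Set.Ioc 0 T) volume)
    (r : ℝ → ℝ → ℝ) (D : ℕ → ℝ → ℝ → ℝ)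
    (hD0 : ∀ t μ, D 0 t μ = r t μ)
    (hD_loc : ∀ (n : ℕ) (μ : ℝ) (T : ℝ), 0 < T →
      IntegrableOn (fun t => D n t μ) (Set.Ioc 0 T) volume)
    (hr_eq : ∀ μ : ℝ, ∀ᵐ t ∂volume, 0 < t →
      r t μ + μ * hconv ℓ (fun s => r s μ) t = ℓ t)
    (hD_deriv : ∀ (n : ℕ) (μ : ℝ), ∀ᵐ t ∂volume, 0 < t →
      HasDerivAt (fun ν => D n t ν) (D (n + 1) t μ) μ)
    (hD_eq : ∀ n : ℕ, 1 ≤ n → ∀ μ : ℝ, ∀ᵐ t ∂volume, 0 < t →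
      D n t μ + μ * hconv ℓ (fun s => D n s μ) t
        = -(n : ℝ) * hconv ℓ (fun s => D (n - 1) s μ) t) :
    ∀ (n : ℕ) (μ : ℝ), ∀ᵐ t ∂volume, 0 < t →
      D n t μ = (-1 : ℝ) ^ n * (n.factorial : ℝ) * convPow (fun s => r s μ) n t := by
  intro n μ
  have hℓ : LocIntegrableHalfLine ℓ := hℓ_loc
  have hd : ∀ n, LocIntegrableHalfLine (fun t => D n t μ) := fun n => hD_loc n μ
  have hr : LocIntegrableHalfLine (fun t => r t μ) := by simpa only [hD0] using hd 0
  have hres : (fun t => r t μ) + μ • hconv ℓ (fun t => r t μ) =ᵐ[halfLineMeasure] ℓ :=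
    ae_halfLine_iff.2 (hr_eq μ)
  rw [← ae_halfLine_iff]
  induction n with
  | zero => exact Filter.Eventually.of_forall fun t => by simp [hD0, convPow]
  | succ n ih =>
    set c := convPow (fun s => r s μ) n with hc_def
    have hc : LocIntegrableHalfLine c := hr.convPow n
    set a : ℝ := (-1) ^ n * (n.factorial : ℝ) with ha
    set d := fun t => D (n + 1) t μ
    have hrc := hr.hconv hc
    have ih' : (fun t => D n t μ) =ᵐ[halfLineMeasure] a • c := ih
    have h₁ := hconv_ae_congr (Filter.EventuallyEq.refl (ae halfLineMeasure) ℓ) ih'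
    rw [hconv_smul_right] at h₁
    have h₂ := ae_halfLine_iff.2 (hD_eq (n + 1) (by omega) μ)
    have h₃ := hconv_add_right hℓ (hd (n + 1)) (hrc.smul ((n + 1 : ℝ) * a))
    rw [hconv_smul_right] at h₃
    have h₀ := volterra_ae_eq_zero (w := d + ((n + 1 : ℝ) * a) • hconv (fun t => r t μ) c)
      hℓ hr ((hd (n + 1)).add (hrc.smul _)) hres (by
        filter_upwards [h₁, h₂, h₃, resolvent_hconv hℓ hr hc hres] with t h₁ h₂ h₃ h₄
        simp only [Pi.add_apply, Pi.smul_apply, Pi.zero_apply, smul_eq_mul,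
          Nat.add_sub_cancel, Nat.cast_add, Nat.cast_one] at h₁ h₂ h₃ h₄ ⊢
        rw [h₃]
        rw [h₁] at h₂
        linear_combination h₂ + (n + 1 : ℝ) * a * h₄)
    filter_upwards [h₀] with t h₀
    simp only [Pi.add_apply, Pi.smul_apply, Pi.zero_apply, smul_eq_mul] at h₀
    rw [convPow, ← hc_def, Nat.factorial_succ, pow_succ]
    push_cast
    rw [ha] at h₀
    linear_combination h₀
end

section
/- Let f : (0,∞) → ℝ be infinitely differentiable with (−1)^j f^{(j)}(x) ≥ 0 for every integer j ≥ 0 and every x > 0 (i.e. f is completely monotone). Then for every integer n ≥ 0 and every x > 0, x^n |f^{(n)}(x)| ≤ 2^n · n! · f(x/2). -/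
open MeasureTheory Real Set

/-- On `(0, ∞)`, the Taylor polynomial of a completely monotone function, evaluated to the left
of its centre, is at most the value of the function. -/
theorem taylorWithinEval_le_of_completelyMonotone {f : ℝ → ℝ}
    (hf : ContDiffOn ℝ (⊤ : ℕ∞) f (Ioi 0))
    (hcm : ∀ (j : ℕ) (x : ℝ), 0 < x → 0 ≤ (-1 : ℝ) ^ j * iteratedDerivWithin j f (Ioi 0) x)
    (n : ℕ) {x y : ℝ} (hy : 0 < y) (hyx : y ≤ x) :
    taylorWithinEval f n (Ioi 0) x y ≤ f y := by
  have hfn : ContDiffOn ℝ n f (Ioi 0) := hf.of_le (by exact_mod_cast le_top)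
  have hsub : Icc y x ⊆ Ioi 0 := fun t ht => hy.trans_le ht.1
  have hderiv : ∀ t ∈ Ioi (0 : ℝ), HasDerivAt (fun s => taylorWithinEval f n (Ioi 0) s y)
      (((n.factorial : ℝ)⁻¹ * (y - t) ^ n) • iteratedDerivWithin (n + 1) f (Ioi 0) t) t :=
    fun t ht => (hasDerivWithinAt_taylorWithinEval (uniqueDiffOn_Ioi 0) self_mem_nhdsWithin ht
      subset_rfl hfn (hf.differentiableOn_iteratedDerivWithin
        (by exact_mod_cast WithTop.coe_lt_top n) (uniqueDiffOn_Ioi 0) t ht)).hasDerivAt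
      (Ioi_mem_nhds ht)
  have hanti : AntitoneOn (fun s => taylorWithinEval f n (Ioi 0) s y) (Icc y x) := by
    refine antitoneOn_of_deriv_nonpos (convex_Icc y x)
      (fun t ht => (hderiv t (hsub ht)).continuousAt.continuousWithinAt)
      (fun t ht => (hderiv t (hsub (interior_subset ht))).differentiableAt.differentiableWithinAt)
      fun t ht => ?_
    have htI := interior_subset ht
    rw [(hderiv t (hsub htI)).deriv, smul_eq_mul, ← neg_sub t y, neg_pow]
    have hsign := hcm (n + 1) t (hsub htI)
    have hpow : 0 ≤ (n.factorial : ℝ)⁻¹ * (t - y) ^ n :=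
      mul_nonneg (by positivity) (pow_nonneg (sub_nonneg.2 htI.1) n)
    have hprod := mul_nonneg hpow hsign
    rw [pow_succ] at hprod
    linarith
  simpa using hanti (left_mem_Icc.2 hyx) (right_mem_Icc.2 hyx) hyx

/-- Each term of the Taylor expansion of a completely monotone function, centred at `x` and
evaluated at `y ≤ x`, is at most `f y`. -/
theorem sub_pow_mul_abs_iteratedDerivWithin_le_of_completelyMonotone {f : ℝ → ℝ}
    (hf : ContDiffOn ℝ (⊤ : ℕ∞) f (Ioi 0))
    (hcm : ∀ (j : ℕ) (x : ℝ), 0 < x → 0 ≤ (-1 : ℝ) ^ j * iteratedDerivWithin j f (Ioi 0) x)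
    (n : ℕ) {x y : ℝ} (hy : 0 < y) (hyx : y ≤ x) :
    (x - y) ^ n * |iteratedDerivWithin n f (Ioi 0) x| ≤ n.factorial * f y := by
  have habs : ∀ k, (y - x) ^ k * iteratedDerivWithin k f (Ioi 0) x =
      (x - y) ^ k * |iteratedDerivWithin k f (Ioi 0) x| := fun k => by
    have hk := abs_of_nonneg (hcm k x (hy.trans_le hyx))
    rw [abs_mul, abs_neg_one_pow, one_mul] at hk
    rw [hk, ← neg_sub x y, neg_pow]
    ring
  have htaylor := taylorWithinEval_le_of_completelyMonotone hf hcm n hy hyx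
  simp only [taylor_within_apply, smul_eq_mul, mul_assoc, habs] at htaylor
  have hterm := (Finset.single_le_sum (f := fun k : ℕ => (k.factorial : ℝ)⁻¹ *
      ((x - y) ^ k * |iteratedDerivWithin k f (Ioi 0) x|))
    (fun k _ => mul_nonneg (by positivity)
      (mul_nonneg (pow_nonneg (sub_nonneg.2 hyx) k) (abs_nonneg _)))
    (Finset.self_mem_range_succ n)).trans htaylor
  rwa [inv_mul_le_iff₀ (by positivity)] at hterm

/-- Let `f : (0,∞) → ℝ` be infinitely differentiable with `(-1)^j f^{(j)}(x) ≥ 0` for every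
`j ≥ 0` and `x > 0` (i.e. `f` is completely monotone).  Then for every `n ≥ 0` and `x > 0`,
`x^n |f^{(n)}(x)| ≤ 2^n n! f(x/2)`. -/
theorem statement2 (f : ℝ → ℝ)
    (hf : ContDiffOn ℝ (⊤ : ℕ∞) f (Set.Ioi 0))
    (hcm : ∀ (j : ℕ) (x : ℝ), 0 < x →
      0 ≤ (-1 : ℝ) ^ j * iteratedDerivWithin j f (Set.Ioi 0) x) :
    ∀ (n : ℕ) (x : ℝ), 0 < x →
      x ^ n * |iteratedDerivWithin n f (Set.Ioi 0) x| ≤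
        2 ^ n * (n.factorial : ℝ) * f (x / 2) := by
  intro n x hx
  have h := sub_pow_mul_abs_iteratedDerivWithin_le_of_completelyMonotone hf hcm n
    (half_pos hx) (half_le_self hx.le)
  rw [sub_half, div_pow, div_mul_eq_mul_div, div_le_iff₀ (by positivity)] at h
  linarith
end

section
/- Let ℓ : (0,∞) → [0,∞) be nonincreasing and locally integrable on [0,∞), and let μ ≥ 0. Let r_μ be a nonnegative locally integrable function on [0,∞) with r_μ(t) + μ(ℓ∗r_μ)(t) = ℓ(t) for a.e. t > 0, and assume that 1 − μ(1∗r_μ)(t) ≤ 1/(1 + μ(1∗ℓ)(t)) for all t > 0. Then (1∗r_μ)(t) ≥ (1∗ℓ)(t)/(1 + μ(1∗ℓ)(t)) for all t > 0, and r_μ(t) ≤ ℓ(t)/(1 + μ(1∗ℓ)(t)) for a.e. t > 0. -/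
open MeasureTheory Real Set

/-- The half-line convolution of locally integrable functions exists almost everywhere. -/
theorem ae_integrableOn_hconv {f g : ℝ → ℝ}
    (hf : ∀ T, 0 < T → IntegrableOn f (Set.Ioc 0 T) volume)
    (hg : ∀ T, 0 < T → IntegrableOn g (Set.Ioc 0 T) volume) :
    ∀ᵐ t ∂volume, IntegrableOn (fun s => f (t - s) * g s) (Set.Ioo 0 t) volume := by
  have hn : ∀ n : ℕ, ∀ᵐ t ∂(volume : Measure ℝ),
      ConvolutionExistsAt ((Set.Ioc (0:ℝ) (n + 1)).indicator g)
        ((Set.Ioc (0:ℝ) (n + 1)).indicator f) t (ContinuousLinearMap.mul ℝ ℝ) volume := by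
    intro n
    have hpos : (0:ℝ) < n + 1 := by positivity
    exact Integrable.ae_convolution_exists _
      ((integrable_indicator_iff measurableSet_Ioc).2 (hg _ hpos))
      ((integrable_indicator_iff measurableSet_Ioc).2 (hf _ hpos))
  filter_upwards [ae_all_iff.2 hn] with t ht
  obtain ⟨n, hnt⟩ := exists_nat_ge t
  refine ((ht n).integrableOn (s := Set.Ioo 0 t)).congr_fun ?_ measurableSet_Ioo
  rintro s ⟨hs0, hst⟩
  have hs : s ∈ Set.Ioc (0:ℝ) (n + 1) := ⟨hs0, by linarith⟩
  have hts : t - s ∈ Set.Ioc (0:ℝ) (n + 1) := ⟨by linarith, by linarith⟩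
  simp [Set.indicator_of_mem hs, Set.indicator_of_mem hts, mul_comm]

/-- Since `f` is nonincreasing and `g ≥ 0`, `f(t) (1 ∗ g)(t) ≤ (f ∗ g)(t)`. -/
theorem mul_oneConv_le_hconv {f g : ℝ → ℝ} {t : ℝ} (ht : 0 < t)
    (hf : AntitoneOn f (Set.Ioi 0)) (hg_nonneg : ∀ s, 0 < s → 0 ≤ g s)
    (hg : IntegrableOn g (Set.Ioc 0 t) volume)
    (hfg : IntegrableOn (fun s => f (t - s) * g s) (Set.Ioo 0 t) volume) :
    f t * oneConv g t ≤ hconv f g t := by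
  rw [hconv, oneConv, intervalIntegral.integral_of_le ht.le, intervalIntegral.integral_of_le ht.le,
    integral_Ioc_eq_integral_Ioo, integral_Ioc_eq_integral_Ioo, ← integral_const_mul]
  refine setIntegral_mono_on ((hg.mono_set Set.Ioo_subset_Ioc_self).const_mul _) hfg
    measurableSet_Ioo fun s hs => ?_
  have hts : (0:ℝ) < t - s := sub_pos.2 hs.2
  exact mul_le_mul_of_nonneg_right (hf hts ht (by linarith [hs.1])) (hg_nonneg s hs.1)

/-- Let `ℓ : (0,∞) → [0,∞)` be nonincreasing and locally integrable and `μ ≥ 0`.  Let `r_μ` be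
nonnegative, locally integrable, with `r_μ + μ (ℓ ∗ r_μ) = ℓ` a.e., and assume the upper bound
`1 - μ (1 ∗ r_μ)(t) ≤ 1/(1 + μ (1 ∗ ℓ)(t))` for all `t > 0`.  Then
`(1 ∗ r_μ)(t) ≥ (1 ∗ ℓ)(t)/(1 + μ (1 ∗ ℓ)(t))` for all `t > 0`, and
`r_μ(t) ≤ ℓ(t)/(1 + μ (1 ∗ ℓ)(t))` for a.e. `t > 0`. -/
theorem statement3 (ℓ : ℝ → ℝ)
    (hℓ_nonneg : ∀ t, 0 < t → 0 ≤ ℓ t)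
    (hℓ_anti : AntitoneOn ℓ (Set.Ioi 0))
    (hℓ_loc : ∀ T, 0 < T → IntegrableOn ℓ (Set.Ioc 0 T) volume)
    (μ : ℝ) (hμ : 0 ≤ μ) (rμ : ℝ → ℝ)
    (hr_nonneg : ∀ t, 0 < t → 0 ≤ rμ t)
    (hr_loc : ∀ T, 0 < T → IntegrableOn rμ (Set.Ioc 0 T) volume)
    (hr_eq : ∀ᵐ t ∂volume, 0 < t → rμ t + μ * hconv ℓ rμ t = ℓ t)
    (hs_up : ∀ t, 0 < t → 1 - μ * oneConv rμ t ≤ 1 / (1 + μ * oneConv ℓ t)) :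
    (∀ t, 0 < t → oneConv ℓ t / (1 + μ * oneConv ℓ t) ≤ oneConv rμ t) ∧
    (∀ᵐ t ∂volume, 0 < t → rμ t ≤ ℓ t / (1 + μ * oneConv ℓ t)) := by
  have hL : ∀ t, 0 < t → 0 ≤ oneConv ℓ t := fun t ht => by
    rw [oneConv, intervalIntegral.integral_of_le ht.le]
    exact setIntegral_nonneg measurableSet_Ioc fun s hs => hℓ_nonneg s hs.1
  refine ⟨fun t ht => ?_, ?_⟩
  · have hden : 0 < 1 + μ * oneConv ℓ t := by
      have := mul_nonneg hμ (hL t ht)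
      linarith
    rcases hμ.eq_or_lt with rfl | hμ_pos
    · have heq : oneConv ℓ t = oneConv rμ t := by
        refine intervalIntegral.integral_congr_ae ?_
        filter_upwards [hr_eq] with s hs hst
        rw [Set.uIoc_of_le ht.le] at hst
        linarith [hs hst.1]
      simp [heq]
    · have h := hs_up t ht
      rw [le_div_iff₀ hden] at h
      rw [div_le_iff₀ hden]
      refine le_of_mul_le_mul_left ?_ hμ_pos
      linarith
  · filter_upwards [hr_eq, ae_integrableOn_hconv hℓ_loc hr_loc] with t hrt hint ht
    have hlow := mul_le_mul_of_nonneg_left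
      (mul_oneConv_le_hconv ht hℓ_anti hr_nonneg (hr_loc t ht) hint) hμ
    have hup := mul_le_mul_of_nonneg_left (hs_up t ht) (hℓ_nonneg t ht)
    rw [mul_one_div] at hup
    linarith [hrt ht]
end

section
/- Let δ ∈ [0,1] and n ∈ ℕ. There exists a constant C = C(n,δ) > 0 with the following property: for all constants A, L > 0 and every infinitely differentiable function f : (0,∞) → [0,∞) satisfying μ^j |f^{(j)}(μ)| ≤ 2^j j! f(μ/2) for all integers 0 ≤ j ≤ n and all μ > 0, and f(μ) ≤ L/(1+μA) for all μ > 0, the function φ(μ) := μ^δ f(μ) satisfies μ^n |φ^{(n)}(μ)| ≤ C · L · A^{−δ} for all μ > 0. -/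
open MeasureTheory Real Set

/-- The scale-invariant size of the derivatives of `x ^ r` on the positive half-line. -/
lemma pow_mul_abs_iteratedDerivWithin_rpow_const (r : ℝ) (k : ℕ) {x : ℝ} (hx : 0 < x) :
    x ^ k * |iteratedDerivWithin k (fun y : ℝ => y ^ r) (Set.Ioi 0) x| =
      |(descPochhammer ℝ k).eval r| * x ^ r := by
  rw [iteratedDerivWithin_of_isOpen_eq_iterate isOpen_Ioi (Set.mem_Ioi.2 hx),
    Real.iter_deriv_rpow_const, abs_mul, abs_of_pos (Real.rpow_pos_of_pos hx _),
    Real.rpow_sub hx, Real.rpow_natCast]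
  field_simp

/-- The interpolation `x ^ δ ≤ (1 + x A) A ^ (-δ)` for `δ ∈ [0, 1]`. -/
lemma rpow_le_one_add_mul_mul_rpow_neg {δ x A : ℝ} (hδ : δ ∈ Set.Icc (0 : ℝ) 1)
    (hx : 0 < x) (hA : 0 < A) : x ^ δ ≤ (1 + x * A) * A ^ (-δ) := by
  have hxA : 0 < x * A := mul_pos hx hA
  have h : (x * A) ^ δ ≤ 1 + x * A :=
    calc (x * A) ^ δ ≤ (1 + x * A) ^ δ :=
          Real.rpow_le_rpow hxA.le (by linarith) hδ.1
      _ ≤ (1 + x * A) ^ (1 : ℝ) := Real.rpow_le_rpow_of_exponent_le (by linarith) hδ.2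
      _ = 1 + x * A := Real.rpow_one _
  rw [Real.mul_rpow hx.le hA.le] at h
  rwa [Real.rpow_neg hA.le, ← div_eq_mul_inv, le_div_iff₀ (Real.rpow_pos_of_pos hA δ)]

/-- Let `δ ∈ [0,1]` and `n ∈ ℕ`.  There is a constant `C = C(n,δ) > 0` such that for all
`A, L > 0` and every smooth `f : (0,∞) → [0,∞)` with
`μ^j |f^{(j)}(μ)| ≤ 2^j j! f(μ/2)` for all `0 ≤ j ≤ n`, `μ > 0`, and
`f(μ) ≤ L/(1 + μ A)` for all `μ > 0`, the function `φ(μ) = μ^δ f(μ)` satisfies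
`μ^n |φ^{(n)}(μ)| ≤ C L A^{-δ}` for all `μ > 0`. -/
theorem statement4 (δ : ℝ) (hδ : δ ∈ Set.Icc (0:ℝ) 1) (n : ℕ) :
    ∃ C : ℝ, 0 < C ∧ ∀ (A L : ℝ), 0 < A → 0 < L → ∀ f : ℝ → ℝ,
      ContDiffOn ℝ (⊤ : ℕ∞) f (Set.Ioi 0) →
      (∀ x, 0 < x → 0 ≤ f x) →
      (∀ j : ℕ, j ≤ n → ∀ μ : ℝ, 0 < μ →
        μ ^ j * |iteratedDerivWithin j f (Set.Ioi 0) μ| ≤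
          2 ^ j * (j.factorial : ℝ) * f (μ / 2)) →
      (∀ μ : ℝ, 0 < μ → f μ ≤ L / (1 + μ * A)) →
      ∀ μ : ℝ, 0 < μ →
        μ ^ n * |iteratedDerivWithin n (fun x => x ^ δ * f x) (Set.Ioi 0) μ| ≤
          C * L * A ^ (-δ) := by
  refine ⟨∑ i ∈ Finset.range (n + 1), (n.choose i : ℝ) * |(descPochhammer ℝ i).eval δ| *
    (2 ^ (n - i) * ((n - i).factorial : ℝ)) * 2 + 1, by positivity, ?_⟩
  intro A L hA hL f hf _ hder hbd μ hμ
  have hLA : 0 < L * A ^ (-δ) := mul_pos hL (Real.rpow_pos_of_pos hA _)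
  have key : μ ^ δ * f (μ / 2) ≤ 2 * (L * A ^ (-δ)) := by
    have hpos : 0 < 1 + μ / 2 * A := by positivity
    calc μ ^ δ * f (μ / 2)
        ≤ ((1 + μ * A) * A ^ (-δ)) * (L / (1 + μ / 2 * A)) :=
          (mul_le_mul_of_nonneg_left (hbd _ (half_pos hμ)) (by positivity)).trans
            (mul_le_mul_of_nonneg_right (rpow_le_one_add_mul_mul_rpow_neg hδ hμ hA)
              (by positivity))
      _ = (1 + μ * A) / (1 + μ / 2 * A) * (L * A ^ (-δ)) := by ring
      _ ≤ 2 * (L * A ^ (-δ)) := by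
          refine mul_le_mul_of_nonneg_right ?_ hLA.le
          rw [div_le_iff₀ hpos]
          linarith
  have hg : ContDiffWithinAt ℝ n (fun x : ℝ => x ^ δ) (Set.Ioi 0) μ :=
    (Real.contDiffAt_rpow_const_of_ne hμ.ne').contDiffWithinAt
  have hf' : ContDiffWithinAt ℝ n f (Set.Ioi 0) μ :=
    (hf μ hμ).of_le (mod_cast le_top)
  have hmul := iteratedDerivWithin_mul (Set.mem_Ioi.2 hμ) (uniqueDiffOn_Ioi 0) hg hf'
  simp only [Pi.mul_def] at hmul
  rw [hmul]
  calc _ ≤ μ ^ n * ∑ i ∈ Finset.range (n + 1), |(n.choose i : ℝ) *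
          iteratedDerivWithin i (fun x : ℝ => x ^ δ) (Set.Ioi 0) μ *
          iteratedDerivWithin (n - i) f (Set.Ioi 0) μ| := by
        gcongr
        exact Finset.abs_sum_le_sum_abs _ _
    _ ≤ ∑ i ∈ Finset.range (n + 1), (n.choose i : ℝ) * |(descPochhammer ℝ i).eval δ| *
          (2 ^ (n - i) * ((n - i).factorial : ℝ)) * 2 * (L * A ^ (-δ)) := by
        rw [Finset.mul_sum]
        refine Finset.sum_le_sum fun i hi => ?_
        have hin : i ≤ n := Nat.lt_succ_iff.1 (Finset.mem_range.1 hi)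
        have hpow : μ ^ n = μ ^ i * μ ^ (n - i) := by rw [← pow_add, Nat.add_sub_cancel' hin]
        calc _ = (n.choose i : ℝ) *
              (μ ^ i * |iteratedDerivWithin i (fun x : ℝ => x ^ δ) (Set.Ioi 0) μ|) *
              (μ ^ (n - i) * |iteratedDerivWithin (n - i) f (Set.Ioi 0) μ|) := by
              rw [abs_mul, abs_mul, Nat.abs_cast, hpow]
              ring
          _ ≤ (n.choose i : ℝ) * (|(descPochhammer ℝ i).eval δ| * μ ^ δ) *
              (2 ^ (n - i) * ((n - i).factorial : ℝ) * f (μ / 2)) := by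
              rw [pow_mul_abs_iteratedDerivWithin_rpow_const δ i hμ]
              exact mul_le_mul_of_nonneg_left (hder _ (Nat.sub_le n i) μ hμ) (by positivity)
          _ = (n.choose i : ℝ) * |(descPochhammer ℝ i).eval δ| *
              (2 ^ (n - i) * ((n - i).factorial : ℝ)) * (μ ^ δ * f (μ / 2)) := by ring
          _ ≤ _ := by
              rw [mul_assoc _ 2 (L * A ^ (-δ))]
              exact mul_le_mul_of_nonneg_left key (by positivity)
    _ ≤ _ := by
        rw [← Finset.sum_mul, mul_assoc _ L]
        exact mul_le_mul_of_nonneg_right (le_add_of_nonneg_right zero_le_one) hLA.le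
end

section
/- Let d ∈ ℕ, ρ > 0, δ ∈ (0,1], and set N := ⌊d/2⌋ + 1. Let ℓ be a nonnegative locally integrable function on [0,∞) with (1∗ℓ)(t) > 0 for all t > 0, and let s : (0,∞)×(0,∞) → ℝ be such that for each t > 0 the map ψ_δ : μ ↦ μ^δ s(t,μ) is C^∞ on (0,∞) and there exist constants C_0, …, C_N, independent of t, with μ^n |ψ_δ^{(n)}(μ)| · (1∗ℓ)(t)^δ ≤ C_n for all μ > 0 and all 0 ≤ n ≤ N. Then for each t > 0 the function m(ξ) := |ξ|^{ρδ} s(t,|ξ|^ρ) (1∗ℓ)(t)^δ is C^∞ on ℝ^d∖{0} and satisfies Mihlin's condition with a constant M depending only on d, ρ, δ and C_0, …, C_N; in particular M is uniform in t. -/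
open MeasureTheory Real Set

/-- The partial derivative `∂_{ξ_j} f` of a function on `ℝ^d`. -/
noncomputable def pderivE (d : ℕ) (j : Fin d) (f : EuclideanSpace ℝ (Fin d) → ℝ) :
    EuclideanSpace ℝ (Fin d) → ℝ :=
  fun x => fderiv ℝ f x (EuclideanSpace.single j 1)

/-- Iterated partial derivatives `∂^β f` along a list of coordinate directions; every
multi-index `β ∈ ℕ₀^d` corresponds to such lists (with `β_j` occurrences of `j`). -/
noncomputable def multiPDeriv (d : ℕ) :
    List (Fin d) → (EuclideanSpace ℝ (Fin d) → ℝ) → EuclideanSpace ℝ (Fin d) → ℝ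
  | [], f => f
  | j :: L, f => pderivE d j (multiPDeriv d L f)

lemma norm_iteratedFDerivWithin_comp_const_smul_le {E F : Type*} [NormedAddCommGroup E]
    [NormedSpace ℝ E] [NormedAddCommGroup F] [NormedSpace ℝ F] {f : E → F} {U : Set E}
    (hU : UniqueDiffOn ℝ U) {n : WithTop ℕ∞} (hf : ContDiffOn ℝ n f U) {c : ℝ}
    (hc : ∀ x, c • x ∈ U ↔ x ∈ U) {i : ℕ} (hi : i ≤ n) {x : E} (hx : x ∈ U) :
    ‖iteratedFDerivWithin ℝ i (fun y => f (c • y)) U x‖ ≤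
      ‖iteratedFDerivWithin ℝ i f U (c • x)‖ * |c| ^ i := by
  set g : E →L[ℝ] E := c • ContinuousLinearMap.id ℝ E
  have hpre : g ⁻¹' U = U := Set.ext hc
  have key := g.iteratedFDerivWithin_comp_right hf hU (hpre.symm ▸ hU) (x := x)
    ((hc x).2 hx) hi
  rw [hpre] at key
  change ‖iteratedFDerivWithin ℝ i (f ∘ g) U x‖ ≤ _
  rw [key]
  refine (ContinuousMultilinearMap.norm_compContinuousLinearMap_le _ _).trans ?_
  have hg : ‖g‖ ≤ |c| := by
    refine (norm_smul_le c (ContinuousLinearMap.id ℝ E)).trans ?_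
    exact mul_le_of_le_one_right (norm_nonneg c) ContinuousLinearMap.norm_id_le
  rw [Finset.prod_const, Finset.card_univ, Fintype.card_fin]
  exact mul_le_mul_of_nonneg_left (pow_le_pow_left₀ (norm_nonneg g) hg i) (norm_nonneg _)

lemma contDiffOn_norm_rpow {E : Type*} [NormedAddCommGroup E] [InnerProductSpace ℝ E] (ρ : ℝ)
    (n : WithTop ℕ∞) : ContDiffOn ℝ n (fun x : E => ‖x‖ ^ ρ) {0}ᶜ :=
  fun _ hx => ((contDiffAt_norm ℝ hx).rpow_const_of_ne (norm_ne_zero_iff.2 hx)).contDiffWithinAt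

lemma exists_bound_iteratedFDerivWithin_norm_rpow (E : Type*) [NormedAddCommGroup E]
    [InnerProductSpace ℝ E] [FiniteDimensional ℝ E] (ρ : ℝ) (N : ℕ) :
    ∃ D : ℝ, 1 ≤ D ∧ ∀ i ≤ N, ∀ x : E, ‖x‖ = 1 →
      ‖iteratedFDerivWithin ℝ i (fun y : E => ‖y‖ ^ ρ) {0}ᶜ x‖ ≤ D := by
  have hb : ∀ i : ℕ, ∃ B : ℝ, ∀ x ∈ Metric.sphere (0 : E) 1,
      ‖iteratedFDerivWithin ℝ i (fun y : E => ‖y‖ ^ ρ) {0}ᶜ x‖ ≤ B := fun i =>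
    (isCompact_sphere (0 : E) 1).exists_bound_of_continuousOn
      (((contDiffOn_norm_rpow ρ ((i : ℕ) : WithTop ℕ∞)).continuousOn_iteratedFDerivWithin le_rfl
        isOpen_compl_singleton.uniqueDiffOn).mono fun x hx => by
          rintro rfl
          simp at hx)
  choose B hB using hb
  refine ⟨1 + ∑ i ∈ Finset.range (N + 1), |B i|,
    le_add_of_nonneg_right (Finset.sum_nonneg fun i _ => abs_nonneg _), fun i hi x hx => ?_⟩
  have h1 := hB i x (by simpa using hx)
  have h2 := Finset.single_le_sum (f := fun i => |B i|) (fun i _ => abs_nonneg _)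
    (Finset.mem_range.2 (Nat.lt_succ_of_le hi))
  have h3 := le_abs_self (B i)
  linarith

/-- Mihlin-type bounds for `φ` on the half line pass to the radial function `φ (‖ξ‖ ^ ρ)`. -/
lemma exists_bound_iteratedFDerivWithin_radial (E : Type*) [NormedAddCommGroup E]
    [InnerProductSpace ℝ E] [FiniteDimensional ℝ E] (ρ : ℝ) (N : ℕ) :
    ∃ D : ℝ, 1 ≤ D ∧ ∀ (φ : ℝ → ℝ) (B : ℝ), ContDiffOn ℝ (⊤ : ℕ∞) φ (Set.Ioi 0) →
      (∀ i ≤ N, ∀ μ : ℝ, 0 < μ → μ ^ i * |iteratedDerivWithin i φ (Set.Ioi 0) μ| ≤ B) →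
      ∀ n ≤ N, ∀ ξ : E, ξ ≠ 0 →
        ‖ξ‖ ^ n * ‖iteratedFDerivWithin ℝ n (fun ζ : E => φ (‖ζ‖ ^ ρ)) {0}ᶜ ξ‖ ≤
          N.factorial * B * D ^ N := by
  obtain ⟨D, hD1, hD⟩ := exists_bound_iteratedFDerivWithin_norm_rpow E ρ N
  refine ⟨D, hD1, fun φ B hφ hB n hn ξ hξ => ?_⟩
  have hU : UniqueDiffOn ℝ ({0}ᶜ : Set E) := isOpen_compl_singleton.uniqueDiffOn
  have hI : UniqueDiffOn ℝ (Set.Ioi (0 : ℝ)) := isOpen_Ioi.uniqueDiffOn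
  have hr : 0 < ‖ξ‖ := norm_pos_iff.2 hξ
  set r := ‖ξ‖
  set c := r ^ ρ
  have hc : 0 < c := Real.rpow_pos_of_pos hr ρ
  have hB0 : 0 ≤ B := (by positivity : (0:ℝ) ≤ _).trans (hB 0 (Nat.zero_le _) 1 one_pos)
  have hcI : ∀ x : ℝ, c • x ∈ Set.Ioi (0 : ℝ) ↔ x ∈ Set.Ioi (0 : ℝ) := fun x => by
    simp [mul_pos_iff_of_pos_left hc]
  have hrU : ∀ x : E, r⁻¹ • x ∈ ({0}ᶜ : Set E) ↔ x ∈ ({0}ᶜ : Set E) := fun x => by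
    simp [hr.ne']
  have hcomp : (fun ζ : E => φ (‖ζ‖ ^ ρ)) =
      (fun μ : ℝ => φ (c • μ)) ∘ (fun ζ : E => ‖r⁻¹ • ζ‖ ^ ρ) := by
    funext ζ
    simp only [Function.comp_apply, smul_eq_mul, norm_smul, norm_inv, Real.norm_eq_abs,
      abs_of_pos hr]
    rw [← Real.mul_rpow hr.le (by positivity), mul_inv_cancel_left₀ hr.ne']
  have hone : ‖r⁻¹ • ξ‖ = 1 := by
    rw [norm_smul, norm_inv, Real.norm_eq_abs, abs_of_pos hr, inv_mul_cancel₀ hr.ne']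
  have hbound : ‖iteratedFDerivWithin ℝ n (fun ζ : E => φ (‖ζ‖ ^ ρ)) {0}ᶜ ξ‖ ≤
      n.factorial * B * (D * r⁻¹) ^ n := by
    rw [hcomp]
    refine norm_iteratedFDerivWithin_comp_le (N := (⊤ : ℕ∞)) (t := Set.Ioi 0)
      (hφ.comp (contDiff_const_smul c).contDiffOn fun x hx => (hcI x).2 hx)
      ((contDiffOn_norm_rpow ρ _).comp (contDiff_const_smul r⁻¹).contDiffOn
        fun x hx => (hrU x).2 hx)
      (by exact_mod_cast le_top) hI hU
      (fun x hx => Real.rpow_pos_of_pos (norm_pos_iff.2 ((hrU x).2 hx)) ρ) hξ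
      (fun i hi => ?_) (fun i hi1 hi => ?_)
    · change ‖iteratedFDerivWithin ℝ i (fun μ : ℝ => φ (c • μ)) (Set.Ioi 0) (‖r⁻¹ • ξ‖ ^ ρ)‖ ≤ B
      rw [hone, Real.one_rpow]
      refine (norm_iteratedFDerivWithin_comp_const_smul_le hI hφ hcI
        (by exact_mod_cast le_top) (Set.mem_Ioi.2 one_pos)).trans ?_
      rw [norm_iteratedFDerivWithin_eq_norm_iteratedDerivWithin, abs_of_pos hc, smul_eq_mul,
        mul_one, mul_comm]
      exact hB i (hi.trans hn) c hc
    · refine (norm_iteratedFDerivWithin_comp_const_smul_le hU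
        (contDiffOn_norm_rpow ρ (⊤ : ℕ∞)) hrU (by exact_mod_cast le_top) hξ).trans ?_
      rw [mul_pow, abs_of_pos (inv_pos.2 hr)]
      gcongr
      exact (hD i (hi.trans hn) _ hone).trans (le_self_pow₀ hD1 (by omega))
  calc r ^ n * ‖iteratedFDerivWithin ℝ n (fun ζ : E => φ (‖ζ‖ ^ ρ)) {0}ᶜ ξ‖
      ≤ r ^ n * (n.factorial * B * (D * r⁻¹) ^ n) := by gcongr
    _ = n.factorial * B * D ^ n := by
      rw [mul_pow, inv_pow]
      field_simp
    _ ≤ N.factorial * B * D ^ N := by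
      gcongr

lemma multiPDeriv_eq_iteratedFDerivWithin {d : ℕ} {f : EuclideanSpace ℝ (Fin d) → ℝ}
    {U : Set (EuclideanSpace ℝ (Fin d))} (hU : IsOpen U) (hf : ContDiffOn ℝ (⊤ : ℕ∞) f U)
    (L : List (Fin d)) : ∀ x ∈ U, multiPDeriv d L f x =
      iteratedFDerivWithin ℝ L.length f U x fun i => EuclideanSpace.single (L.get i) 1 := by
  induction L with
  | nil => intro x _; simp [multiPDeriv]
  | cons j L ih =>
    intro x hx
    have heq : multiPDeriv d L f =ᶠ[nhds x] fun y =>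
        iteratedFDerivWithin ℝ L.length f U y fun i => EuclideanSpace.single (L.get i) 1 :=
      Filter.eventuallyEq_of_mem (hU.mem_nhds hx) ih
    have hdiff : DifferentiableAt ℝ (iteratedFDerivWithin ℝ L.length f U) x :=
      (hf.differentiableOn_iteratedFDerivWithin (by exact_mod_cast ENat.natCast_lt_top _)
        hU.uniqueDiffOn).differentiableAt (hU.mem_nhds hx)
    change fderiv ℝ (multiPDeriv d L f) x (EuclideanSpace.single j 1) = _
    rw [heq.fderiv_eq, fderiv_continuousMultilinear_apply_const_apply hdiff]
    change _ = iteratedFDerivWithin ℝ (L.length + 1) f U x _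
    rw [iteratedFDerivWithin_succ_apply_left, fderivWithin_of_isOpen hU hx]
    rfl

lemma abs_multiPDeriv_le {d : ℕ} {f : EuclideanSpace ℝ (Fin d) → ℝ}
    {U : Set (EuclideanSpace ℝ (Fin d))} (hU : IsOpen U) (hf : ContDiffOn ℝ (⊤ : ℕ∞) f U)
    (L : List (Fin d)) {x : EuclideanSpace ℝ (Fin d)} (hx : x ∈ U) :
    |multiPDeriv d L f x| ≤ ‖iteratedFDerivWithin ℝ L.length f U x‖ := by
  rw [multiPDeriv_eq_iteratedFDerivWithin hU hf L x hx, ← Real.norm_eq_abs]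
  refine (ContinuousMultilinearMap.le_opNorm _ _).trans ?_
  simp

/-- Mihlin's multiplier lemma for the relaxation function: if for each `t > 0` the map
`ψ_δ : μ ↦ μ^δ s(t,μ)` is `C^∞` on `(0,∞)` with
`μ^n |ψ_δ^{(n)}(μ)| (1∗ℓ)(t)^δ ≤ C_n` for all `0 ≤ n ≤ ⌊d/2⌋+1`, then for each `t > 0` the
symbol `m(ξ) = |ξ|^{ρδ} s(t,|ξ|^ρ) (1∗ℓ)(t)^δ` is `C^∞` away from the origin and satisfies
Mihlin's condition `|ξ|^{|β|} |∂^β m(ξ)| ≤ M` for all `|β| ≤ ⌊d/2⌋+1`, with a constant `M`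
depending only on `d`, `ρ`, `δ` and the `C_n` — in particular uniform in `t`. -/
theorem statement8 (d : ℕ) (hd : 0 < d) (ρ δ : ℝ) (hρ : 0 < ρ)
    (hδ : δ ∈ Set.Ioc (0:ℝ) 1) (C : ℕ → ℝ) :
    ∃ M : ℝ, 0 < M ∧
      ∀ (ℓ : ℝ → ℝ) (s : ℝ → ℝ → ℝ),
        (∀ t, 0 < t → 0 ≤ ℓ t) →
        (∀ T, 0 < T → IntegrableOn ℓ (Set.Ioc 0 T) volume) →
        (∀ t, 0 < t → 0 < oneConv ℓ t) →
        (∀ t, 0 < t → ContDiffOn ℝ (⊤ : ℕ∞) (fun μ : ℝ => μ ^ δ * s t μ) (Set.Ioi 0)) →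
        (∀ t, 0 < t → ∀ n : ℕ, n ≤ d / 2 + 1 → ∀ μ : ℝ, 0 < μ →
          μ ^ n * |iteratedDerivWithin n (fun ν : ℝ => ν ^ δ * s t ν) (Set.Ioi 0) μ| *
            oneConv ℓ t ^ δ ≤ C n) →
        ∀ t, 0 < t →
          ContDiffOn ℝ (⊤ : ℕ∞)
            (fun ξ : EuclideanSpace ℝ (Fin d) =>
              ‖ξ‖ ^ (ρ * δ) * s t (‖ξ‖ ^ ρ) * oneConv ℓ t ^ δ)
            {(0 : EuclideanSpace ℝ (Fin d))}ᶜ ∧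
          ∀ L : List (Fin d), L.length ≤ d / 2 + 1 →
            ∀ ξ : EuclideanSpace ℝ (Fin d), ξ ≠ 0 →
              ‖ξ‖ ^ (L.length : ℕ) *
                |multiPDeriv d L
                  (fun ζ => ‖ζ‖ ^ (ρ * δ) * s t (‖ζ‖ ^ ρ) * oneConv ℓ t ^ δ) ξ| ≤ M := by
  obtain ⟨D, hD1, hD⟩ := exists_bound_iteratedFDerivWithin_radial (EuclideanSpace ℝ (Fin d)) ρ
    (d / 2 + 1)
  set B : ℝ := ∑ i ∈ Finset.range (d / 2 + 1 + 1), |C i|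
  have hB0 : 0 ≤ B := Finset.sum_nonneg fun i _ => abs_nonneg _
  refine ⟨(d / 2 + 1).factorial * B * D ^ (d / 2 + 1) + 1, by positivity,
    fun ℓ s _ _ hpos hsmooth hbound t ht => ?_⟩
  set K : ℝ := oneConv ℓ t ^ δ
  have hK : 0 < K := Real.rpow_pos_of_pos (hpos t ht) δ
  set φ : ℝ → ℝ := K • fun μ : ℝ => μ ^ δ * s t μ
  have hφ : ContDiffOn ℝ (⊤ : ℕ∞) φ (Set.Ioi 0) := (hsmooth t ht).const_smul K
  have hφB : ∀ i ≤ d / 2 + 1, ∀ μ : ℝ, 0 < μ →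
      μ ^ i * |iteratedDerivWithin i φ (Set.Ioi 0) μ| ≤ B := by
    intro i hi μ hμ
    have hci : ContDiffWithinAt ℝ i (fun μ : ℝ => μ ^ δ * s t μ) (Set.Ioi 0) μ :=
      (hsmooth t ht μ hμ).of_le (by exact_mod_cast le_top)
    rw [iteratedDerivWithin_const_smul (s := Set.Ioi 0) hμ isOpen_Ioi.uniqueDiffOn K hci, smul_eq_mul, abs_mul,
      abs_of_pos hK, mul_comm K, ← mul_assoc]
    exact (hbound t ht i hi μ hμ).trans <| (le_abs_self _).trans <|
      Finset.single_le_sum (f := fun i => |C i|) (fun i _ => abs_nonneg _)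
        (Finset.mem_range.2 (Nat.lt_succ_of_le hi))
  have hm : (fun ξ : EuclideanSpace ℝ (Fin d) => ‖ξ‖ ^ (ρ * δ) * s t (‖ξ‖ ^ ρ) * K) =
      fun ξ => φ (‖ξ‖ ^ ρ) := by
    funext ξ
    simp only [φ, Pi.smul_apply, smul_eq_mul]
    rw [Real.rpow_mul (norm_nonneg ξ), mul_comm K]
  have hmsmooth : ContDiffOn ℝ (⊤ : ℕ∞) (fun ξ : EuclideanSpace ℝ (Fin d) => φ (‖ξ‖ ^ ρ)) {0}ᶜ :=
    hφ.comp (contDiffOn_norm_rpow ρ _) fun x hx =>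
      Real.rpow_pos_of_pos (norm_pos_iff.2 hx) ρ
  rw [hm]
  refine ⟨hmsmooth, fun L hL ξ hξ => ?_⟩
  calc ‖ξ‖ ^ L.length * |multiPDeriv d L (fun ζ => φ (‖ζ‖ ^ ρ)) ξ|
      ≤ ‖ξ‖ ^ L.length *
          ‖iteratedFDerivWithin ℝ L.length
            (fun ζ : EuclideanSpace ℝ (Fin d) => φ (‖ζ‖ ^ ρ)) {0}ᶜ ξ‖ := by
        gcongr
        exact abs_multiPDeriv_le isOpen_compl_singleton hmsmooth L hξ
    _ ≤ (d / 2 + 1).factorial * B * D ^ (d / 2 + 1) := hD φ B hφ hφB L.length hL ξ hξ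
    _ ≤ _ := le_add_of_nonneg_right zero_le_one
end

section
/- Let d ∈ ℕ, ρ > 0, δ ∈ [0,1], and set N := ⌊d/2⌋ + 1. Let ℓ : (0,∞) → (0,∞) be locally integrable on [0,∞) with (1∗ℓ)(t) > 0 for all t > 0, and let r : (0,∞)×(0,∞) → ℝ be such that for each t > 0 the map φ_δ : μ ↦ μ^δ r(t,μ) is C^∞ on (0,∞) and there exist constants C_0, …, C_N, independent of t, with μ^n |φ_δ^{(n)}(μ)| · (1∗ℓ)(t)^δ · ℓ(t)^{−1} ≤ C_n for all μ > 0 and all 0 ≤ n ≤ N. Then for each t > 0 the function m(ξ) := |ξ|^{ρδ} r(t,|ξ|^ρ) (1∗ℓ)(t)^δ ℓ(t)^{−1} is C^∞ on ℝ^d∖{0} and satisfies Mihlin's condition with a constant M depending only on d, ρ, δ and C_0, …, C_N; in particular M is uniform in t. -/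
open MeasureTheory Real Set

/-- Smooth functions on `E ∖ {0}` that are positively homogeneous of degree `s`. -/
structure SmoothHomogeneous {E : Type*} [NormedAddCommGroup E] [NormedSpace ℝ E]
    (s : ℝ) (b : E → ℝ) : Prop where
  contDiffOn : ContDiffOn ℝ (⊤ : ℕ∞) b {(0 : E)}ᶜ
  map_smul : ∀ a : ℝ, 0 < a → ∀ x : E, x ≠ 0 → b (a • x) = a ^ s * b x

namespace SmoothHomogeneous

section NormedSpace

variable {E : Type*} [NormedAddCommGroup E] [NormedSpace ℝ E] {s s' : ℝ} {b c : E → ℝ}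

theorem zero (s : ℝ) : SmoothHomogeneous s (fun _ : E => (0 : ℝ)) :=
  ⟨contDiffOn_const, by simp⟩

theorem add (hb : SmoothHomogeneous s b) (hc : SmoothHomogeneous s c) :
    SmoothHomogeneous s (fun x => b x + c x) :=
  ⟨hb.contDiffOn.add hc.contDiffOn, fun a ha x hx => by
    simp only [hb.map_smul a ha x hx, hc.map_smul a ha x hx, mul_add]⟩

theorem mul (hb : SmoothHomogeneous s b) (hc : SmoothHomogeneous s' c) :
    SmoothHomogeneous (s + s') (fun x => b x * c x) :=
  ⟨hb.contDiffOn.mul hc.contDiffOn, fun a ha x hx => by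
    simp only [hb.map_smul a ha x hx, hc.map_smul a ha x hx, Real.rpow_add ha]; ring⟩

theorem differentiableAt (hb : SmoothHomogeneous s b) {x : E} (hx : x ≠ 0) :
    DifferentiableAt ℝ b x :=
  (hb.contDiffOn.differentiableOn (by simp)).differentiableAt
    (isOpen_compl_singleton.mem_nhds hx)

theorem fderiv_apply (hb : SmoothHomogeneous s b) (v : E) :
    SmoothHomogeneous (s - 1) (fun x => fderiv ℝ b x v) := by
  refine ⟨(hb.contDiffOn.fderiv_of_isOpen isOpen_compl_singleton (by simp)).clm_apply
    contDiffOn_const, fun a ha x hx => ?_⟩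
  have hax : a • x ≠ 0 := smul_ne_zero ha.ne' hx
  have h1 : HasFDerivAt (fun y => b (a • y))
      ((fderiv ℝ b (a • x)).comp (a • ContinuousLinearMap.id ℝ E)) x :=
    (hb.differentiableAt hax).hasFDerivAt.comp x ((hasFDerivAt_id x).const_smul a)
  have h2 : HasFDerivAt (fun y => a ^ s * b y) (a ^ s • fderiv ℝ b x) x :=
    (hb.differentiableAt hx).hasFDerivAt.const_mul _
  have h3 : (fun y => b (a • y)) =ᶠ[nhds x] fun y => a ^ s * b y := by
    filter_upwards [isOpen_compl_singleton.mem_nhds hx] with y hy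
    exact hb.map_smul a ha y hy
  have h4 := congrArg (fun T : E →L[ℝ] ℝ => T v) ((h1.congr_of_eventuallyEq h3.symm).unique h2)
  simp only [ContinuousLinearMap.comp_apply, smul_apply,
    ContinuousLinearMap.id_apply, _root_.map_smul, smul_eq_mul] at h4
  rw [Real.rpow_sub_one ha.ne', div_mul_eq_mul_div, eq_div_iff ha.ne', ← h4, mul_comm]

theorem exists_bound [FiniteDimensional ℝ E] (hb : SmoothHomogeneous s b) :
    ∃ K : ℝ, 0 ≤ K ∧ ∀ x : E, x ≠ 0 → |b x| ≤ K * ‖x‖ ^ s := by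
  have hsub : Metric.sphere (0 : E) 1 ⊆ {(0 : E)}ᶜ := fun x hx h => by
    simp [Set.mem_singleton_iff.1 h] at hx
  obtain ⟨K, hK⟩ := (isCompact_sphere (0 : E) 1).exists_bound_of_continuousOn
    (hb.contDiffOn.continuousOn.mono hsub)
  refine ⟨|K|, abs_nonneg K, fun x hx => ?_⟩
  have hx' : 0 < ‖x‖ := norm_pos_iff.2 hx
  have hu : ‖‖x‖⁻¹ • x‖ = 1 := by
    rw [norm_smul, norm_inv, norm_norm, inv_mul_cancel₀ hx'.ne']
  have h := hb.map_smul ‖x‖ hx' (‖x‖⁻¹ • x) (by rw [← norm_ne_zero_iff, hu]; exact one_ne_zero)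
  rw [smul_inv_smul₀ hx'.ne'] at h
  rw [h, abs_mul, abs_of_nonneg (Real.rpow_nonneg hx'.le s), mul_comm]
  exact mul_le_mul_of_nonneg_right ((hK _ (by simpa using hu)).trans (le_abs_self K))
    (Real.rpow_nonneg hx'.le s)

end NormedSpace

theorem norm_rpow {E : Type*} [NormedAddCommGroup E] [InnerProductSpace ℝ E] (s : ℝ) :
    SmoothHomogeneous s (fun x : E => ‖x‖ ^ s) :=
  ⟨fun _ hx => ((contDiffAt_norm ℝ hx).rpow_const_of_ne
      (norm_ne_zero_iff.2 hx)).contDiffWithinAt,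
    fun a ha x _ => by
      simp only [norm_smul, Real.norm_of_nonneg ha.le, Real.mul_rpow ha.le (norm_nonneg x)]⟩

end SmoothHomogeneous

theorem ContDiffOn.hasDerivAt_iteratedDerivWithin_Ioi {φ : ℝ → ℝ}
    (hφ : ContDiffOn ℝ (⊤ : ℕ∞) φ (Ioi 0)) (n : ℕ) {μ : ℝ} (hμ : 0 < μ) :
    HasDerivAt (iteratedDerivWithin n φ (Ioi 0))
      (iteratedDerivWithin (n + 1) φ (Ioi 0) μ) μ := by
  have h := (hφ.differentiableOn_iteratedDerivWithin (m := n)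
    (by exact_mod_cast WithTop.coe_lt_top n) (uniqueDiffOn_Ioi 0) μ hμ).hasDerivWithinAt
  rw [iteratedDerivWithin_succ]
  exact h.hasDerivAt (Ioi_mem_nhds hμ)

/-- Faà di Bruno expansion of the partial derivatives of a radial function `φ(|ξ|^ρ)`, with
coefficients that do not depend on `φ`. -/
theorem exists_multiPDeriv_comp_norm_rpow_eq_sum (d : ℕ) (ρ : ℝ) (L : List (Fin d)) :
    ∃ b : ℕ → EuclideanSpace ℝ (Fin d) → ℝ,
      (∀ n : ℕ, SmoothHomogeneous (ρ * n - L.length) (b n)) ∧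
      (∀ n, L.length < n → b n = fun _ => 0) ∧
      ∀ φ : ℝ → ℝ, ContDiffOn ℝ (⊤ : ℕ∞) φ (Ioi 0) → ∀ ξ : EuclideanSpace ℝ (Fin d), ξ ≠ 0 →
        multiPDeriv d L (fun ζ => φ (‖ζ‖ ^ ρ)) ξ =
          ∑ n ∈ Finset.range (L.length + 1),
            b n ξ * iteratedDerivWithin n φ (Ioi 0) (‖ξ‖ ^ ρ) := by
  induction L with
  | nil =>
    refine ⟨fun n => if n = 0 then fun ξ => ‖ξ‖ ^ (0 : ℝ) else fun _ => 0, fun n => ?_,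
      fun n hn => ?_, fun φ _ ξ _ => by simp [multiPDeriv]⟩
    · by_cases h : n = 0
      · simpa [h] using SmoothHomogeneous.norm_rpow (E := EuclideanSpace ℝ (Fin d)) 0
      · simpa [h] using SmoothHomogeneous.zero (E := EuclideanSpace ℝ (Fin d)) (ρ * n)
    · have : n ≠ 0 := by rintro rfl; simp at hn
      simp [this]
  | cons j L ih =>
    obtain ⟨b, hb, hb0, hsum⟩ := ih
    set v : EuclideanSpace ℝ (Fin d) := EuclideanSpace.single j 1 with hv
    set p : EuclideanSpace ℝ (Fin d) → ℝ := fun ξ => ‖ξ‖ ^ ρ with hp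
    have hpH : SmoothHomogeneous ρ p := SmoothHomogeneous.norm_rpow ρ
    refine ⟨fun n ξ => fderiv ℝ (b n) ξ v +
      (match n with
        | 0 => fun _ => 0
        | k + 1 => fun ξ => b k ξ * fderiv ℝ p ξ v : EuclideanSpace ℝ (Fin d) → ℝ) ξ,
      fun n => ?_, fun n hn => ?_, fun φ hφ ξ hξ => ?_⟩
    · have h1 := (hb n).fderiv_apply v
      have e : ρ * n - ((j :: L).length : ℕ) = ρ * n - L.length - 1 := by
        simp only [List.length_cons]; push_cast; ring
      rw [e]
      refine h1.add ?_
      cases n with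
      | zero => exact SmoothHomogeneous.zero _
      | succ k =>
        have h2 := (hb k).mul (hpH.fderiv_apply v)
        convert h2 using 1
        push_cast; ring
    · simp only [List.length_cons] at hn
      cases n with
      | zero => omega
      | succ k =>
        funext ξ
        simp [hb0 (k + 1) (by omega), hb0 k (by omega)]
    · have hpos : 0 < p ξ := Real.rpow_pos_of_pos (norm_pos_iff.2 hξ) ρ
      have hev : multiPDeriv d L (fun ζ => φ (‖ζ‖ ^ ρ)) =ᶠ[nhds ξ] fun ξ =>
          ∑ n ∈ Finset.range (L.length + 1),
            b n ξ * iteratedDerivWithin n φ (Ioi 0) (p ξ) := by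
        filter_upwards [isOpen_compl_singleton.mem_nhds hξ] with y hy
        exact hsum φ hφ y hy
      have hd : HasFDerivAt (fun ξ => ∑ n ∈ Finset.range (L.length + 1),
            b n ξ * iteratedDerivWithin n φ (Ioi 0) (p ξ)) _ ξ :=
        HasFDerivAt.fun_sum fun n _ => ((hb n).differentiableAt hξ).hasFDerivAt.mul
          ((hφ.hasDerivAt_iteratedDerivWithin_Ioi n hpos).comp_hasFDerivAt ξ
            (hpH.differentiableAt hξ).hasFDerivAt)
      simp only [multiPDeriv, pderivE]
      rw [hev.fderiv_eq, hd.fderiv, List.length_cons]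
      simp only [add_mul, Finset.sum_add_distrib]
      rw [Finset.sum_range_succ (fun n => fderiv ℝ (b n) ξ v * _),
        Finset.sum_range_succ' _ (L.length + 1), hb0 (L.length + 1) (by omega)]
      simp only [sum_apply, add_apply,
        smul_apply, smul_eq_mul, fderiv_fun_const,
        Pi.zero_apply, zero_apply, zero_mul, add_zero, ← hv]
      rw [add_comm]
      congr 1
      · exact Finset.sum_congr rfl fun n _ => mul_comm _ _
      · exact Finset.sum_congr rfl fun n _ => by ring

theorem exists_bound_multiPDeriv_comp_norm_rpow (d : ℕ) (ρ : ℝ) (C : ℕ → ℝ)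
    (L : List (Fin d)) :
    ∃ M : ℝ, ∀ φ : ℝ → ℝ, ContDiffOn ℝ (⊤ : ℕ∞) φ (Ioi 0) →
      (∀ n ≤ L.length, ∀ μ : ℝ, 0 < μ → μ ^ n * |iteratedDerivWithin n φ (Ioi 0) μ| ≤ C n) →
      ∀ ξ : EuclideanSpace ℝ (Fin d), ξ ≠ 0 →
        ‖ξ‖ ^ L.length * |multiPDeriv d L (fun ζ => φ (‖ζ‖ ^ ρ)) ξ| ≤ M := by
  obtain ⟨b, hb, -, hsum⟩ := exists_multiPDeriv_comp_norm_rpow_eq_sum d ρ L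
  choose K hK0 hK using fun n => (hb n).exists_bound
  refine ⟨∑ n ∈ Finset.range (L.length + 1), K n * C n, fun φ hφ hC ξ hξ => ?_⟩
  have hξ' : 0 < ‖ξ‖ := norm_pos_iff.2 hξ
  rw [hsum φ hφ ξ hξ]
  refine (mul_le_mul_of_nonneg_left (Finset.abs_sum_le_sum_abs _ _) (by positivity)).trans ?_
  rw [Finset.mul_sum]
  refine Finset.sum_le_sum fun n hn => ?_
  have hCn := hC n (Nat.lt_succ_iff.1 (Finset.mem_range.1 hn)) (‖ξ‖ ^ ρ)
    (Real.rpow_pos_of_pos hξ' ρ)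
  have e : ‖ξ‖ ^ L.length * ‖ξ‖ ^ (ρ * n - L.length) = (‖ξ‖ ^ ρ) ^ n := by
    rw [← Real.rpow_natCast ‖ξ‖ L.length, ← Real.rpow_add hξ', add_sub_cancel,
      Real.rpow_mul_natCast hξ'.le]
  rw [abs_mul]
  calc ‖ξ‖ ^ L.length * (|b n ξ| * |iteratedDerivWithin n φ (Ioi 0) (‖ξ‖ ^ ρ)|)
      ≤ ‖ξ‖ ^ L.length * (K n * ‖ξ‖ ^ (ρ * n - L.length) *
          |iteratedDerivWithin n φ (Ioi 0) (‖ξ‖ ^ ρ)|) := by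
        gcongr
        exact hK n ξ hξ
    _ = K n * ((‖ξ‖ ^ ρ) ^ n * |iteratedDerivWithin n φ (Ioi 0) (‖ξ‖ ^ ρ)|) := by
        rw [← e]; ring
    _ ≤ K n * C n := mul_le_mul_of_nonneg_left hCn (hK0 n)

/-- Mihlin's multiplier lemma for the resolvent kernel: if for each `t > 0` the map
`φ_δ : μ ↦ μ^δ r(t,μ)` is `C^∞` on `(0,∞)` with
`μ^n |φ_δ^{(n)}(μ)| (1∗ℓ)(t)^δ ℓ(t)^{-1} ≤ C_n` for all `0 ≤ n ≤ ⌊d/2⌋+1`, then for each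
`t > 0` the symbol `m(ξ) = |ξ|^{ρδ} r(t,|ξ|^ρ) (1∗ℓ)(t)^δ ℓ(t)^{-1}` is `C^∞` away from the
origin and satisfies Mihlin's condition `|ξ|^{|β|} |∂^β m(ξ)| ≤ M` for all
`|β| ≤ ⌊d/2⌋+1`, with a constant `M` depending only on `d`, `ρ`, `δ` and the `C_n` — in
particular uniform in `t`. -/
theorem statement9 (d : ℕ) (hd : 0 < d) (ρ δ : ℝ) (hρ : 0 < ρ)
    (hδ : δ ∈ Set.Icc (0:ℝ) 1) (C : ℕ → ℝ) :
    ∃ M : ℝ, 0 < M ∧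
      ∀ (ℓ : ℝ → ℝ) (r : ℝ → ℝ → ℝ),
        (∀ t, 0 < t → 0 < ℓ t) →
        (∀ T, 0 < T → IntegrableOn ℓ (Set.Ioc 0 T) volume) →
        (∀ t, 0 < t → 0 < oneConv ℓ t) →
        (∀ t, 0 < t → ContDiffOn ℝ (⊤ : ℕ∞) (fun μ : ℝ => μ ^ δ * r t μ) (Set.Ioi 0)) →
        (∀ t, 0 < t → ∀ n : ℕ, n ≤ d / 2 + 1 → ∀ μ : ℝ, 0 < μ →
          μ ^ n * |iteratedDerivWithin n (fun ν : ℝ => ν ^ δ * r t ν) (Set.Ioi 0) μ| *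
            oneConv ℓ t ^ δ * (ℓ t)⁻¹ ≤ C n) →
        ∀ t, 0 < t →
          ContDiffOn ℝ (⊤ : ℕ∞)
            (fun ξ : EuclideanSpace ℝ (Fin d) =>
              ‖ξ‖ ^ (ρ * δ) * r t (‖ξ‖ ^ ρ) * oneConv ℓ t ^ δ * (ℓ t)⁻¹)
            {(0 : EuclideanSpace ℝ (Fin d))}ᶜ ∧
          ∀ L : List (Fin d), L.length ≤ d / 2 + 1 →
            ∀ ξ : EuclideanSpace ℝ (Fin d), ξ ≠ 0 →
              ‖ξ‖ ^ (L.length : ℕ) *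
                |multiPDeriv d L
                  (fun ζ => ‖ζ‖ ^ (ρ * δ) * r t (‖ζ‖ ^ ρ) * oneConv ℓ t ^ δ * (ℓ t)⁻¹) ξ| ≤ M := by
  choose M hM using exists_bound_multiPDeriv_comp_norm_rpow d ρ C
  have hfin : {L : List (Fin d) | L.length ≤ d / 2 + 1}.Finite := List.finite_length_le _ _
  refine ⟨1 + ∑ L ∈ hfin.toFinset, |M L|, by positivity, fun ℓ r hℓ _ hI hr hC t ht => ?_⟩
  set c : ℝ := oneConv ℓ t ^ δ * (ℓ t)⁻¹ with hc
  have hc0 : 0 < c := mul_pos (Real.rpow_pos_of_pos (hI t ht) δ) (inv_pos.2 (hℓ t ht))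
  set φ : ℝ → ℝ := fun μ => c * (μ ^ δ * r t μ) with hφdef
  have hφ : ContDiffOn ℝ (⊤ : ℕ∞) φ (Ioi 0) := contDiffOn_const.mul (hr t ht)
  have hm : (fun ξ : EuclideanSpace ℝ (Fin d) =>
      ‖ξ‖ ^ (ρ * δ) * r t (‖ξ‖ ^ ρ) * oneConv ℓ t ^ δ * (ℓ t)⁻¹) = fun ξ => φ (‖ξ‖ ^ ρ) := by
    funext ξ
    simp only [hφdef, hc, Real.rpow_mul (norm_nonneg ξ)]
    ring
  rw [hm]
  refine ⟨hφ.comp (SmoothHomogeneous.norm_rpow ρ).contDiffOn fun ξ hξ =>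
    Real.rpow_pos_of_pos (norm_pos_iff.2 hξ) ρ, fun L hL ξ hξ => ?_⟩
  refine (hM L φ hφ (fun n hn μ hμ => ?_) ξ hξ).trans ?_
  · have h := hC t ht n (hn.trans hL) μ hμ
    rw [hφdef, iteratedDerivWithin_const_mul (mem_Ioi.2 hμ) (uniqueDiffOn_Ioi 0) c
      (((hr t ht).of_le (by exact_mod_cast le_top)) μ hμ), abs_mul, abs_of_pos hc0]
    calc _ = _ := by rw [hc]; ring
      _ ≤ C n := h
  · have h := Finset.single_le_sum (f := fun L => |M L|) (fun L _ => abs_nonneg (M L))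
      (hfin.mem_toFinset.2 hL)
    linarith [le_abs_self (M L)]
end
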